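/- arXiv:2211.05519 — 3 statements merged into one kernel-verified Lean document; each statement's English description precedes it below -/
import Mathlib

section
/- Let Λ be a ring and e ∈ Λ an idempotent such that eΛ(1−e) = 0. Then the induction functor − ⊗_{eΛe} eΛ : Mod(eΛe) → Mod(Λ) is fully faithful and exact, sends projective eΛe-modules to projective Λ-modules, and sends finitely generated modules to finitely generated modules. Consequently fin.dim Λ ≥ fin.dim eΛe and Fin.dim Λ ≥ Fin.dim eΛe. -/
set_option linter.unusedSectionVars false
set_option synthInstance.maxHeartbeats 1000000
set_option maxHeartbeats 1600000
set_option linter.unusedVariables false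
set_option linter.unnecessarySeqFocus false

universe u
open MulOpposite Function DirectSum

/-! ### Lower triangular matrix rings -/

/-- The lower triangular matrix ring `[[A,0],[M,B]]` for a `B`-`A`-bimodule `M`
(a left `B`-module with a commuting right `A`-action, the latter written as a
left `Aᵐᵒᵖ`-action). The element `⟨a, m, b⟩` represents the matrix `[[a,0],[m,b]]`. -/
@[ext] structure Tri (A B M : Type u) : Type u where
  a : A
  m : M
  b : B

namespace Tri
variable {A B M : Type u} [Ring A] [Ring B] [AddCommGroup M]
  [Module B M] [Module Aᵐᵒᵖ M] [SMulCommClass B Aᵐᵒᵖ M]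

instance : Zero (Tri A B M) := ⟨⟨0, 0, 0⟩⟩
instance : Add (Tri A B M) := ⟨fun x y => ⟨x.a + y.a, x.m + y.m, x.b + y.b⟩⟩
instance : Neg (Tri A B M) := ⟨fun x => ⟨-x.a, -x.m, -x.b⟩⟩
instance : One (Tri A B M) := ⟨⟨1, 0, 1⟩⟩
instance : Mul (Tri A B M) :=
  ⟨fun x y => ⟨x.a * y.a, op y.a • x.m + x.b • y.m, x.b * y.b⟩⟩

@[simp] lemma zero_a : (0 : Tri A B M).a = 0 := rfl
@[simp] lemma zero_m : (0 : Tri A B M).m = 0 := rfl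
@[simp] lemma zero_b : (0 : Tri A B M).b = 0 := rfl
@[simp] lemma add_a (x y : Tri A B M) : (x + y).a = x.a + y.a := rfl
@[simp] lemma add_m (x y : Tri A B M) : (x + y).m = x.m + y.m := rfl
@[simp] lemma add_b (x y : Tri A B M) : (x + y).b = x.b + y.b := rfl
@[simp] lemma neg_a (x : Tri A B M) : (-x).a = -x.a := rfl
@[simp] lemma neg_m (x : Tri A B M) : (-x).m = -x.m := rfl
@[simp] lemma neg_b (x : Tri A B M) : (-x).b = -x.b := rfl
@[simp] lemma one_a : (1 : Tri A B M).a = 1 := rfl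
@[simp] lemma one_m : (1 : Tri A B M).m = 0 := rfl
@[simp] lemma one_b : (1 : Tri A B M).b = 1 := rfl
@[simp] lemma mul_a (x y : Tri A B M) : (x * y).a = x.a * y.a := rfl
@[simp] lemma mul_m (x y : Tri A B M) : (x * y).m = op y.a • x.m + x.b • y.m := rfl
@[simp] lemma mul_b (x y : Tri A B M) : (x * y).b = x.b * y.b := rfl

instance : AddCommGroup (Tri A B M) where
  add_assoc x y z := by ext <;> simp [add_assoc]
  zero_add x := by ext <;> simp
  add_zero x := by ext <;> simp
  add_comm x y := by ext <;> simp [add_comm]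
  neg_add_cancel x := by ext <;> simp
  nsmul := nsmulRec
  zsmul := zsmulRec

instance : Ring (Tri A B M) :=
  { (inferInstance : AddCommGroup (Tri A B M)),
    (inferInstance : Mul (Tri A B M)),
    (inferInstance : One (Tri A B M)) with
    left_distrib := fun x y z => by
      ext <;> simp [mul_add, smul_add, add_smul] <;> abel
    right_distrib := fun x y z => by
      ext <;> simp [add_mul, smul_add, add_smul] <;> abel
    zero_mul := fun x => by ext <;> simp
    mul_zero := fun x => by ext <;> simp
    mul_assoc := fun x y z => by
      refine Tri.ext (mul_assoc _ _ _) ?_ (mul_assoc _ _ _)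
      simp only [mul_m, mul_b, mul_a, smul_add, op_mul, mul_smul]
      rw [smul_comm x.b (op z.a) y.m]
      abel
    one_mul := fun x => by ext <;> simp
    mul_one := fun x => by ext <;> simp }

end Tri

/-! ### Corner rings -/

/-- The corner ring `eΛe` of a ring `Λ` at an idempotent `e`, with unit `e`. -/
def Corner {Λ : Type u} [Ring Λ] (e : Λ) (_ : IsIdempotentElem e) : Type u :=
  {x : Λ // e * x = x ∧ x * e = x}

namespace Corner
variable {Λ : Type u} [Ring Λ] {e : Λ} {he : IsIdempotentElem e}

instance : Zero (Corner e he) := ⟨⟨0, by simp, by simp⟩⟩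
instance : Add (Corner e he) :=
  ⟨fun x y => ⟨x.1 + y.1, by rw [mul_add, x.2.1, y.2.1], by rw [add_mul, x.2.2, y.2.2]⟩⟩
instance : Neg (Corner e he) :=
  ⟨fun x => ⟨-x.1, by rw [mul_neg, x.2.1], by rw [neg_mul, x.2.2]⟩⟩
instance : Mul (Corner e he) :=
  ⟨fun x y => ⟨x.1 * y.1, by rw [← mul_assoc, x.2.1], by rw [mul_assoc, y.2.2]⟩⟩
instance : One (Corner e he) := ⟨⟨e, he, he⟩⟩

instance : Ring (Corner e he) where
  add_assoc x y z := Subtype.ext (add_assoc _ _ _)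
  zero_add x := Subtype.ext (zero_add _)
  add_zero x := Subtype.ext (add_zero _)
  add_comm x y := Subtype.ext (add_comm _ _)
  neg_add_cancel x := Subtype.ext (neg_add_cancel _)
  nsmul := nsmulRec
  zsmul := zsmulRec
  left_distrib x y z := Subtype.ext (mul_add _ _ _)
  right_distrib x y z := Subtype.ext (add_mul _ _ _)
  zero_mul x := Subtype.ext (zero_mul _)
  mul_zero x := Subtype.ext (mul_zero _)
  mul_assoc x y z := Subtype.ext (mul_assoc _ _ _)
  one_mul x := Subtype.ext x.2.1
  mul_one x := Subtype.ext x.2.2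

end Corner

/-! ### Projective dimension and finitistic dimensions -/

/-- `pdLE R n M` : `M` has projective dimension at most `n` as a left `R`-module. -/
def pdLE (R : Type u) [Ring R] : (n : ℕ) → (M : Type u) → [AddCommGroup M] → [Module R M] → Prop
  | 0, M, _, _ => Module.Projective R M
  | n+1, M, _, _ => ∃ (P : Type u) (_ : AddCommGroup P) (_ : Module R P),
      Module.Projective R P ∧
      ∃ f : P →ₗ[R] M, Function.Surjective f ∧ pdLE R n (LinearMap.ker f)

/-- The projective dimension of a left `R`-module, as an element of `ℕ∞`
(with value `⊤` when no finite projective resolution exists). -/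
noncomputable def projDim (R : Type u) [Ring R] (M : Type u) [AddCommGroup M] [Module R M] : ℕ∞ :=
  sInf {d : ℕ∞ | ∃ n : ℕ, d = n ∧ pdLE R n M}

/-- `fgpdLE R n M` : `M` admits a resolution of length at most `n` by finitely
generated projective left `R`-modules. -/
def fgpdLE (R : Type u) [Ring R] :
    (n : ℕ) → (M : Type u) → [AddCommGroup M] → [Module R M] → Prop
  | 0, M, _, _ => Module.Projective R M ∧ Module.Finite R M
  | n+1, M, _, _ => ∃ (P : Type u) (_ : AddCommGroup P) (_ : Module R P),
      (Module.Projective R P ∧ Module.Finite R P) ∧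
      ∃ f : P →ₗ[R] M, Function.Surjective f ∧ fgpdLE R n (LinearMap.ker f)

/-- The small finitistic dimension of `R`, computed with *left* `R`-modules: the
supremum of the projective dimensions of the left modules admitting a finite
resolution by finitely generated projectives. -/
noncomputable def smallFinDimLeft (R : Type u) [Ring R] : ℕ∞ :=
  sSup {d : ℕ∞ | ∃ (M : Type u) (_ : AddCommGroup M) (_ : Module R M),
    (∃ n : ℕ, fgpdLE R n M) ∧ projDim R M = d}

/-- The big finitistic dimension of `R`, computed with *left* `R`-modules: the
supremum of all finite projective dimensions of left `R`-modules. -/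
noncomputable def bigFinDimLeft (R : Type u) [Ring R] : ℕ∞ :=
  sSup {d : ℕ∞ | d ≠ ⊤ ∧ ∃ (M : Type u) (_ : AddCommGroup M) (_ : Module R M),
    projDim R M = d}

/-- `fin.dim R` : the small finitistic dimension of `R`, computed with right
`R`-modules (= left `Rᵐᵒᵖ`-modules). -/
noncomputable def finDim (R : Type u) [Ring R] : ℕ∞ := smallFinDimLeft Rᵐᵒᵖ

/-- `Fin.dim R` : the big finitistic dimension of `R`, computed with right
`R`-modules (= left `Rᵐᵒᵖ`-modules). -/
noncomputable def bigFinDim (R : Type u) [Ring R] : ℕ∞ := bigFinDimLeft Rᵐᵒᵖ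

/-! ### Radical, socle, perfect and semilocal rings, Morita equivalence -/

/-- The radical of a module: the intersection of all maximal submodules. -/
def moduleRad (R M : Type u) [Ring R] [AddCommGroup M] [Module R M] : Submodule R M :=
  sInf {N : Submodule R M | IsCoatom N}

/-- The socle of a module: the sum of all simple submodules. -/
def moduleSoc (R M : Type u) [Ring R] [AddCommGroup M] [Module R M] : Submodule R M :=
  sSup {N : Submodule R M | IsSimpleModule R ↥N}

/-- A ring is right perfect if every right module has a projective cover,
i.e. a superfluous epimorphism from a projective module. -/
def IsRightPerfect (R : Type u) [Ring R] : Prop :=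
  ∀ (M : Type u) (_ : AddCommGroup M) (_ : Module Rᵐᵒᵖ M),
    ∃ (P : Type u) (_ : AddCommGroup P) (_ : Module Rᵐᵒᵖ P) (f : P →ₗ[Rᵐᵒᵖ] M),
      Module.Projective Rᵐᵒᵖ P ∧ Function.Surjective f ∧
      ∀ N : Submodule Rᵐᵒᵖ P, N ⊔ LinearMap.ker f = ⊤ → N = ⊤

/-- A ring is left perfect if every left module has a projective cover. -/
def IsLeftPerfect (R : Type u) [Ring R] : Prop :=
  ∀ (M : Type u) (_ : AddCommGroup M) (_ : Module R M),
    ∃ (P : Type u) (_ : AddCommGroup P) (_ : Module R P) (f : P →ₗ[R] M),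
      Module.Projective R P ∧ Function.Surjective f ∧
      ∀ N : Submodule R P, N ⊔ LinearMap.ker f = ⊤ → N = ⊤

/-- A ring is semilocal if its quotient by the Jacobson radical is semisimple;
equivalently, there is a surjective ring homomorphism onto a semisimple ring
whose kernel is the Jacobson radical. -/
def IsSemilocal (A : Type u) [Ring A] : Prop :=
  ∃ (T : Type u) (_ : Ring T) (f : A →+* T), Function.Surjective f ∧
    IsSemisimpleRing T ∧ RingHom.ker f = (⊥ : Ideal A).jacobson

/-- Morita equivalence, via the categories of right modules. -/
def MoritaEquiv (R S : Type u) [Ring R] [Ring S] : Prop :=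
  Nonempty (ModuleCat.{u} Rᵐᵒᵖ ≌ ModuleCat.{u} Sᵐᵒᵖ)

/-- Powers of an additive subgroup of a ring (e.g. of the Jacobson radical of a
not necessarily commutative ring), defined via products. -/
def addSubgroupPow {R : Type u} [Ring R] (I : AddSubgroup R) : ℕ → AddSubgroup R
  | 0 => ⊤
  | 1 => I
  | n+2 => AddSubgroup.closure {x : R | ∃ p ∈ I, ∃ q ∈ addSubgroupPow I (n+1), x = p * q}

/-- Left multiplication by a fixed element, as an endomorphism of the right
regular module. -/
def leftMulHom (R : Type u) [Ring R] (z : R) : R →ₗ[Rᵐᵒᵖ] R where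
  toFun x := z * x
  map_add' := mul_add z
  map_smul' r x := (mul_assoc z x r.unop).symm

/-! ### The asymmetric cover -/

/-- The endomorphism ring of the right `A`-module `S i`. -/
abbrev EndS (A : Type u) [Ring A] {ι : Type u} (S : ι → Type u)
    [∀ i, AddCommGroup (S i)] [∀ i, Module Aᵐᵒᵖ (S i)] (i : ι) : Type u :=
  Module.End Aᵐᵒᵖ (S i)

/-- `Ā = ∏_{S ∈ Σ(A)} T(End_A(S))`, the product over the simple right `A`-modules
of the trivial extensions of their endomorphism rings. -/
abbrev Abar (A : Type u) [Ring A] {ι : Type u} (S : ι → Type u)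
    [∀ i, AddCommGroup (S i)] [∀ i, Module Aᵐᵒᵖ (S i)] : Type u :=
  ∀ i, TrivSqZeroExt (EndS A S i) (EndS A S i)

/-- `S̄ = ⊕_{S ∈ Σ(A)} S`, the direct sum of the simple right `A`-modules. -/
abbrev Sbar (A : Type u) [Ring A] {ι : Type u} (S : ι → Type u)
    [∀ i, AddCommGroup (S i)] [∀ i, Module Aᵐᵒᵖ (S i)] : Type u :=
  ⨁ i, S i

/-- The canonical projection `T(B) → B` from a trivial extension, as a ring
homomorphism. -/
def tszeFst (B : Type u) [Ring B] : TrivSqZeroExt B B →+* B where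
  toFun x := x.fst
  map_one' := rfl
  map_mul' _ _ := rfl
  map_zero' := rfl
  map_add' _ _ := rfl

section
variable (A : Type u) [Ring A] {ι : Type u} (S : ι → Type u)
  [∀ i, AddCommGroup (S i)] [∀ i, Module Aᵐᵒᵖ (S i)]

/-- The left `Ā`-action on each simple module `S i`, via `Ā → T(End_A(S i)) → End_A(S i)`. -/
instance instModuleAbarS (i : ι) : Module (Abar A S) (S i) where
  smul r x := (r i).fst x
  one_smul x := rfl
  mul_smul r s x := rfl
  smul_zero r := map_zero _
  smul_add r x y := map_add _ x y
  add_smul r s x := LinearMap.add_apply _ _ _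
  zero_smul x := rfl

lemma abar_smul_def (r : Abar A S) (i : ι) (x : S i) : r • x = (r i).fst x := rfl

instance instSMulCommAbarS (i : ι) : SMulCommClass (Abar A S) Aᵐᵒᵖ (S i) where
  smul_comm r a x := map_smul ((r i).fst) a x

instance instSMulCommAbarSbar : SMulCommClass (Abar A S) Aᵐᵒᵖ (Sbar A S) where
  smul_comm r a x := by
    refine DFinsupp.ext fun i => ?_
    simp only [DirectSum.smul_apply]
    exact smul_comm _ _ _

end

/-- The asymmetric cover `Ã = [[A,0],[S̄,Ā]]` of the ring `A`, relative to a
family `S : ι → Type u` of representatives of the simple right `A`-modules. -/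
abbrev AsymCover (A : Type u) [Ring A] {ι : Type u} (S : ι → Type u)
    [∀ i, AddCommGroup (S i)] [∀ i, Module Aᵐᵒᵖ (S i)] : Type u :=
  Tri A (Abar A S) (Sbar A S)

/-- `S : ι → Type u` is a complete irredundant family of representatives of the
isomorphism classes of simple right `A`-modules. -/
def IsSimpleFamily (A : Type u) [Ring A] {ι : Type u} (S : ι → Type u)
    [∀ i, AddCommGroup (S i)] [∀ i, Module Aᵐᵒᵖ (S i)] : Prop :=
  (∀ i, IsSimpleModule Aᵐᵒᵖ (S i)) ∧
  (∀ (T : Type u) (_ : AddCommGroup T) (_ : Module Aᵐᵒᵖ T),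
    IsSimpleModule Aᵐᵒᵖ T → ∃ i, Nonempty (T ≃ₗ[Aᵐᵒᵖ] S i)) ∧
  (∀ i j, Nonempty (S i ≃ₗ[Aᵐᵒᵖ] S j) → i = j)

/-! ### Comparison with the categorical projective dimension -/

section ProjectiveDimension

open CategoryTheory

lemma hasProjectiveDimensionLE_succ_iff_of_exact {R : Type u} [Ring R] {K P M : Type u}
    [AddCommGroup K] [Module R K] [AddCommGroup P] [Module R P] [AddCommGroup M] [Module R M]
    [Module.Projective R P] (i : K →ₗ[R] P) (g : P →ₗ[R] M) (hi : Function.Injective i)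
    (hg : Function.Surjective g) (hig : Function.Exact i g) (n : ℕ) :
    HasProjectiveDimensionLE (ModuleCat.of R M) (n + 1) ↔
      HasProjectiveDimensionLE (ModuleCat.of R K) n := by
  let T : ShortComplex (ModuleCat.{u} R) :=
    ShortComplex.mk (ModuleCat.ofHom i) (ModuleCat.ofHom g) (by
      ext x
      exact hig.apply_apply_eq_zero x)
  have hT : T.ShortExact := ModuleCat.shortComplex_shortExact T hig hi hg
  exact hT.hasProjectiveDimensionLT_X₃_iff n
    ((IsProjective.iff_projective P).mp inferInstance)

lemma hasProjectiveDimensionLE_zero_iff_projective {R : Type u} [Ring R] {M : Type u}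
    [AddCommGroup M] [Module R M] :
    HasProjectiveDimensionLE (ModuleCat.of R M) 0 ↔ Module.Projective R M := by
  rw [IsProjective.iff_projective, projective_iff_hasProjectiveDimensionLE_zero]

lemma hasProjectiveDimensionLE_succ_iff_ker {R : Type u} [Ring R] {P M : Type u}
    [AddCommGroup P] [Module R P] [AddCommGroup M] [Module R M] [Module.Projective R P]
    (g : P →ₗ[R] M) (hg : Function.Surjective g) (n : ℕ) :
    HasProjectiveDimensionLE (ModuleCat.of R M) (n + 1) ↔
      HasProjectiveDimensionLE (ModuleCat.of R (LinearMap.ker g)) n :=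
  hasProjectiveDimensionLE_succ_iff_of_exact (LinearMap.ker g).subtype g
    (Submodule.subtype_injective _) hg (LinearMap.exact_subtype_ker_map g) n

theorem pdLE_iff_hasProjectiveDimensionLE {R : Type u} [Ring R] (n : ℕ) (M : Type u)
    [AddCommGroup M] [Module R M] :
    pdLE R n M ↔ HasProjectiveDimensionLE (ModuleCat.of R M) n := by
  induction n generalizing M with
  | zero => exact hasProjectiveDimensionLE_zero_iff_projective.symm
  | succ n ih =>
    constructor
    · rintro ⟨P, _, _, _, g, hg, hK⟩
      exact (hasProjectiveDimensionLE_succ_iff_ker g hg n).mpr ((ih _).mp hK)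
    · intro h
      have hg : Function.Surjective (Finsupp.linearCombination R (id : M → M)) :=
        Finsupp.linearCombination_id_surjective R M
      refine ⟨M →₀ R, inferInstance, inferInstance, inferInstance,
        Finsupp.linearCombination R id, hg, (ih _).mpr ?_⟩
      exact (hasProjectiveDimensionLE_succ_iff_ker _ hg n).mp h

end ProjectiveDimension

lemma fgpdLE_of_linearEquiv {R : Type u} [Ring R] (n : ℕ) {M N : Type u}
    [AddCommGroup M] [Module R M] [AddCommGroup N] [Module R N] (E : M ≃ₗ[R] N)
    (h : fgpdLE R n M) : fgpdLE R n N := by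
  cases n with
  | zero =>
    obtain ⟨_, _⟩ := h
    exact ⟨Module.Projective.of_equiv E, Module.Finite.equiv E⟩
  | succ n =>
    obtain ⟨P, _, _, hP, g, hg, hK⟩ := h
    refine ⟨P, inferInstance, inferInstance, hP, E.toLinearMap ∘ₗ g,
      E.surjective.comp hg, ?_⟩
    rwa [LinearEquiv.ker_comp]

/-! ### Restriction of scalars along a surjection onto a projective quotient ring -/

section Restriction

variable {R S : Type u} [Ring R] [Ring S] [Module R S]

lemma Module.Projective.finsupp_of_projective (ι : Type u) [Module.Projective R S] :
    Module.Projective R (ι →₀ S) := by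
  classical
  exact Module.Projective.of_equiv (finsuppLequivDFinsupp (ι := ι) (M := S) R).symm

theorem Module.Projective.restrictScalars_of_projective [Module.Projective R S]
    (M : Type u) [AddCommGroup M] [Module R M] [Module S M] [IsScalarTower R S M]
    [IsScalarTower R S S] [Module.Projective S M] : Module.Projective R M := by
  obtain ⟨s, hs⟩ := Module.projective_def'.mp ‹Module.Projective S M›
  have := Module.Projective.finsupp_of_projective (R := R) (S := S) M
  exact Module.Projective.of_split (s.restrictScalars R)
    ((Finsupp.linearCombination S (id : M → M)).restrictScalars R)
    (LinearMap.ext fun x => LinearMap.congr_fun hs x)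

theorem Module.Projective.of_restrictScalars_of_surjective
    (hRS : Function.Surjective fun r : R => r • (1 : S))
    (M : Type u) [AddCommGroup M] [Module R M] [Module S M] [IsScalarTower R S M]
    [IsScalarTower R S S] [Module.Projective R M] : Module.Projective S M := by
  obtain ⟨s, hs⟩ := Module.projective_lifting_property
    ((Finsupp.linearCombination S (id : M → M)).restrictScalars R) LinearMap.id
    (Finsupp.linearCombination_id_surjective S M)
  let t : M →ₗ[S] M →₀ S :=
    { s with
      map_smul' := fun c x => by
        obtain ⟨r, rfl⟩ := hRS c
        simp }
  exact Module.projective_def'.mpr ⟨t, LinearMap.ext fun x => LinearMap.congr_fun hs x⟩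

variable [IsScalarTower R S S]

theorem pdLE_restrictScalars_iff [Module.Projective R S]
    (hRS : Function.Surjective fun r : R => r • (1 : S)) (n : ℕ)
    (M : Type u) [AddCommGroup M] [Module R M] [Module S M] [IsScalarTower R S M] :
    pdLE R n M ↔ pdLE S n M := by
  induction n generalizing M with
  | zero =>
    exact ⟨fun (_ : Module.Projective R M) =>
        Module.Projective.of_restrictScalars_of_surjective hRS M,
      fun (_ : Module.Projective S M) => Module.Projective.restrictScalars_of_projective (S := S) M⟩
  | succ n ih =>
    let g := Finsupp.linearCombination S (id : M → M)
    have hg : Function.Surjective g := Finsupp.linearCombination_id_surjective S M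
    have := Module.Projective.finsupp_of_projective (R := R) (S := S) M
    let i : LinearMap.ker g →ₗ[R] M →₀ S := (LinearMap.ker g).subtype.restrictScalars R
    have hexact : Function.Exact i (g.restrictScalars R) := LinearMap.exact_subtype_ker_map g
    have hR := hasProjectiveDimensionLE_succ_iff_of_exact (K := LinearMap.ker g) i
      (g.restrictScalars R) (Submodule.subtype_injective _) hg hexact n
    rw [pdLE_iff_hasProjectiveDimensionLE, pdLE_iff_hasProjectiveDimensionLE, hR,
      hasProjectiveDimensionLE_succ_iff_ker g hg,
      ← pdLE_iff_hasProjectiveDimensionLE, ← pdLE_iff_hasProjectiveDimensionLE]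
    exact ih _

theorem projDim_restrictScalars [Module.Projective R S]
    (hRS : Function.Surjective fun r : R => r • (1 : S))
    (M : Type u) [AddCommGroup M] [Module R M] [Module S M] [IsScalarTower R S M] :
    projDim R M = projDim S M := by
  simp only [projDim, pdLE_restrictScalars_iff hRS]

theorem fgpdLE_restrictScalars [Module.Projective R S] [Module.Finite R S] (n : ℕ)
    (M : Type u) [AddCommGroup M] [Module R M] [Module S M] [IsScalarTower R S M]
    (h : fgpdLE S n M) : fgpdLE R n M := by
  induction n generalizing M with
  | zero =>
    obtain ⟨_, _⟩ := h
    exact ⟨Module.Projective.restrictScalars_of_projective (S := S) M, Module.Finite.trans S M⟩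
  | succ n ih =>
    obtain ⟨P, _, _, ⟨_, _⟩, g, hg, hK⟩ := h
    let : Module R P := Module.compHom P (RingHom.smulOneHom : R →+* S)
    have : IsScalarTower R S P := ⟨fun r c x => by
      change (r • c) • x = (r • (1 : S)) • c • x
      rw [← mul_smul, smul_one_mul]⟩
    refine ⟨P, inferInstance, inferInstance,
      ⟨Module.Projective.restrictScalars_of_projective (S := S) P, Module.Finite.trans S P⟩,
      g.restrictScalars R, hg, ?_⟩
    have E : LinearMap.ker g ≃ₗ[R] LinearMap.ker (g.restrictScalars R) :=
      { toFun := fun x => ⟨x.1, x.2⟩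
        invFun := fun x => ⟨x.1, x.2⟩
        map_add' := fun _ _ => rfl
        map_smul' := fun _ _ => rfl }
    exact fgpdLE_of_linearEquiv n E (ih _ hK)

end Restriction

section FinitisticDimension

variable {R S : Type u} [Ring R] [Ring S] (f : R →+* S)

theorem smallFinDimLeft_le_of_surjective (hf : Function.Surjective f)
    (hp : let := Module.compHom S f; Module.Projective R S) :
    smallFinDimLeft S ≤ smallFinDimLeft R := by
  let : Module R S := Module.compHom S f
  have : IsScalarTower R S S := ⟨fun r c x => mul_assoc (f r) c x⟩
  have : Module.Projective R S := hp
  have hRS : Function.Surjective fun r : R => r • (1 : S) := fun c =>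
    (hf c).imp fun r hr => (mul_one (f r)).trans hr
  have : Module.Finite R S := Module.Finite.of_surjective (LinearMap.toSpanSingleton R S 1) hRS
  refine sSup_le_sSup ?_
  rintro d ⟨M, _, _, ⟨n, hn⟩, rfl⟩
  let : Module R M := Module.compHom M f
  have : IsScalarTower R S M := ⟨fun r c x => mul_smul (f r) c x⟩
  exact ⟨M, inferInstance, inferInstance, ⟨n, fgpdLE_restrictScalars n M hn⟩,
    projDim_restrictScalars hRS M⟩

theorem bigFinDimLeft_le_of_surjective (hf : Function.Surjective f)
    (hp : let := Module.compHom S f; Module.Projective R S) :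
    bigFinDimLeft S ≤ bigFinDimLeft R := by
  let : Module R S := Module.compHom S f
  have : IsScalarTower R S S := ⟨fun r c x => mul_assoc (f r) c x⟩
  have : Module.Projective R S := hp
  have hRS : Function.Surjective fun r : R => r • (1 : S) := fun c =>
    (hf c).imp fun r hr => (mul_one (f r)).trans hr
  refine sSup_le_sSup ?_
  rintro d ⟨hd, M, _, _, rfl⟩
  let : Module R M := Module.compHom M f
  have : IsScalarTower R S M := ⟨fun r c x => mul_smul (f r) c x⟩
  exact ⟨hd, M, inferInstance, inferInstance, projDim_restrictScalars hRS M⟩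

end FinitisticDimension

theorem ModuleCat.restrictScalars_full_of_surjective {R S : Type u} [Ring R] [Ring S]
    (f : R →+* S) (hf : Function.Surjective f) : (ModuleCat.restrictScalars.{u} f).Full where
  map_surjective {M N} g :=
    ⟨ModuleCat.ofHom
      { toFun := fun x => g.hom x
        map_add' := fun x y => g.hom.map_add x y
        map_smul' := fun c x => by
          obtain ⟨r, rfl⟩ := hf c
          exact g.hom.map_smul r x }, rfl⟩

/-! ### The corner ring as a quotient -/

namespace Corner

variable {Λ : Type u} [Ring Λ] {e : Λ} {he : IsIdempotentElem e} {φ : Λ →+* Corner e he}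

lemma apply_val_eq_self (hφ : ∀ x : Λ, (φ x).1 = e * x * e) (c : Corner e he) : φ c.1 = c :=
  Subtype.ext <| by rw [hφ, c.2.1, c.2.2]

lemma op_surjective (hφ : ∀ x : Λ, (φ x).1 = e * x * e) :
    Function.Surjective (RingHom.op φ) := fun c =>
  ⟨op c.unop.1, congrArg op (apply_val_eq_self hφ c.unop)⟩

theorem projective_op (h1 : ∀ x : Λ, e * x * (1 - e) = 0)
    (hφ : ∀ x : Λ, (φ x).1 = e * x * e) :
    let := Module.compHom (Corner e he)ᵐᵒᵖ (RingHom.op φ)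
    Module.Projective Λᵐᵒᵖ (Corner e he)ᵐᵒᵖ := by
  let := Module.compHom (Corner e he)ᵐᵒᵖ (RingHom.op φ)
  have hcorner : ∀ x : Λ, e * x * e = e * x := fun x => by
    have := h1 x
    rw [mul_sub, mul_one, sub_eq_zero] at this
    exact this.symm
  let i : (Corner e he)ᵐᵒᵖ →ₗ[Λᵐᵒᵖ] Λᵐᵒᵖ :=
    { toFun := fun c => op c.unop.1
      map_add' := fun _ _ => rfl
      map_smul' := fun r c => unop_injective <| by
        change c.unop.1 * (φ r.unop).1 = c.unop.1 * r.unop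
        rw [hφ, hcorner, ← mul_assoc, c.unop.2.2] }
  refine Module.Projective.of_split i (LinearMap.toSpanSingleton Λᵐᵒᵖ (Corner e he)ᵐᵒᵖ 1) ?_
  refine LinearMap.ext fun c => ?_
  change op (φ c.unop.1) * 1 = c
  rw [mul_one, apply_val_eq_self hφ, op_unop]

end Corner

open CategoryTheory CategoryTheory.Limits in
/-- Let `Λ` be a ring and `e ∈ Λ` an idempotent with
`eΛ(1-e) = 0`.  Then `eΛ = eΛe`, so the induction functor
`- ⊗_{eΛe} eΛ : Mod(eΛe) → Mod(Λ)` is the restriction of scalars along the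
ring homomorphism `Λ → eΛe`, `x ↦ exe`.  This functor is fully faithful and
exact, it sends projectives to projectives and finitely generated modules to
finitely generated modules; consequently `fin.dim Λ ≥ fin.dim eΛe` and
`Fin.dim Λ ≥ Fin.dim eΛe`. -/
theorem induction_functor_of_corner_and_finDim_le
    (Λ : Type u) [Ring Λ] (e : Λ) (he : IsIdempotentElem e)
    (h1 : ∀ x : Λ, e * x * (1 - e) = 0)
    (φ : Λ →+* Corner e he) (hφ : ∀ x : Λ, (φ x).1 = e * x * e) :
    (ModuleCat.restrictScalars.{u} (RingHom.op φ)).Full ∧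
    (ModuleCat.restrictScalars.{u} (RingHom.op φ)).Faithful ∧
    Nonempty (PreservesFiniteLimits (ModuleCat.restrictScalars.{u} (RingHom.op φ))) ∧
    Nonempty (PreservesFiniteColimits (ModuleCat.restrictScalars.{u} (RingHom.op φ))) ∧
    (∀ N : ModuleCat.{u} (Corner e he)ᵐᵒᵖ, Projective N →
      Projective ((ModuleCat.restrictScalars.{u} (RingHom.op φ)).obj N)) ∧
    (∀ N : ModuleCat.{u} (Corner e he)ᵐᵒᵖ, Module.Finite (Corner e he)ᵐᵒᵖ N →
      Module.Finite Λᵐᵒᵖ ((ModuleCat.restrictScalars.{u} (RingHom.op φ)).obj N)) ∧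
    finDim (Corner e he) ≤ finDim Λ ∧
    bigFinDim (Corner e he) ≤ bigFinDim Λ := by
  have hsurj := Corner.op_surjective hφ
  have hproj := Corner.projective_op h1 hφ
  let : Module Λᵐᵒᵖ (Corner e he)ᵐᵒᵖ := Module.compHom _ (RingHom.op φ)
  have : IsScalarTower Λᵐᵒᵖ (Corner e he)ᵐᵒᵖ (Corner e he)ᵐᵒᵖ :=
    ⟨fun r c x => mul_assoc (RingHom.op φ r) c x⟩
  have : Module.Projective Λᵐᵒᵖ (Corner e he)ᵐᵒᵖ := hproj
  have : Module.Finite Λᵐᵒᵖ (Corner e he)ᵐᵒᵖ :=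
    Module.Finite.of_surjective (LinearMap.toSpanSingleton Λᵐᵒᵖ (Corner e he)ᵐᵒᵖ 1)
      fun c => (hsurj c).imp fun r hr => (mul_one (RingHom.op φ r)).trans hr
  refine ⟨ModuleCat.restrictScalars_full_of_surjective _ hsurj, inferInstance,
    ⟨⟨fun _ _ _ => ⟨inferInstance⟩⟩⟩, ⟨⟨fun _ _ _ => ⟨inferInstance⟩⟩⟩, fun N hN => ?_, fun N hN => ?_,
    smallFinDimLeft_le_of_surjective _ hsurj hproj, bigFinDimLeft_le_of_surjective _ hsurj hproj⟩
  · have : Module.Projective (Corner e he)ᵐᵒᵖ N := (IsProjective.iff_projective N).mpr hN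
    let : Module Λᵐᵒᵖ N := Module.compHom N (RingHom.op φ)
    have : IsScalarTower Λᵐᵒᵖ (Corner e he)ᵐᵒᵖ N :=
      ⟨fun r c x => mul_smul (RingHom.op φ r) c x⟩
    exact (IsProjective.iff_projective N).mp
      (Module.Projective.restrictScalars_of_projective (S := (Corner e he)ᵐᵒᵖ) N)
  · let : Module Λᵐᵒᵖ N := Module.compHom N (RingHom.op φ)
    have : IsScalarTower Λᵐᵒᵖ (Corner e he)ᵐᵒᵖ N :=
      ⟨fun r c x => mul_smul (RingHom.op φ r) c x⟩
    exact Module.Finite.trans (R := Λᵐᵒᵖ) (Corner e he)ᵐᵒᵖ N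
end

section
/- Let A be a semilocal ring. Then the ring Â = [[A,0],[A/rad A, T(A/rad A)]] is Morita equivalent to the asymmetric cover Ã = [[A,0],[S̄,Ā]] of A; more precisely, there is an idempotent ε ∈ A/rad A inducing a Morita equivalence A/rad A ∼ ε(A/rad A)ε ≅ ∏_{S ∈ Σ(A)} End_A(S), and for ε̃ = [[1,0],[0,(ε,0)]] one has Â Morita equivalent to ε̃Âε̃ ≅ Ã. -/
set_option linter.unusedSectionVars false
set_option synthInstance.maxHeartbeats 1000000
set_option maxHeartbeats 1600000
set_option linter.unusedVariables false
set_option linter.unnecessarySeqFocus false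

universe u
open MulOpposite Function DirectSum

section HatCover
variable (A T : Type u) [Ring A] [Ring T] (f : A →+* T)

/-- Any ring `T` is a left module over its trivial extension `T(T)`, via the
projection `T(T) → T`. -/
instance instModuleTszeSelf : Module (TrivSqZeroExt T T) T :=
  Module.compHom T (tszeFst T)

/-- A ring homomorphism `f : A → T` makes `T` a right `A`-module. -/
def hatModAop : Module Aᵐᵒᵖ T := Module.compHom T (RingHom.op f)

/-- The left `T(T)`-action and the right `A`-action (via `f`) on `T` commute,
making `T` a `T(T)`-`A`-bimodule. -/
def hatSMulComm :
    letI := hatModAop A T f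
    SMulCommClass (TrivSqZeroExt T T) Aᵐᵒᵖ T := by
  letI := hatModAop A T f
  exact ⟨fun r a x => (mul_assoc r.fst x (f a.unop)).symm⟩

end HatCover

/-! ### Morita equivalence with the corner at a full idempotent -/

namespace Corner

section LeftModules
variable {Λ : Type u} [Ring Λ] (e : Λ) (he : IsIdempotentElem e)

/-- The additive subgroup `eM` of a left module `M`, for an idempotent `e`. -/
def part (e : Λ) (_ : IsIdempotentElem e) (M : Type u) [AddCommGroup M] [Module Λ M] :
    AddSubgroup M where
  carrier := {m | e • m = m}
  zero_mem' := smul_zero e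
  add_mem' {x y} hx hy := by
    simp only [Set.mem_ofPred_eq] at *
    rw [smul_add, hx, hy]
  neg_mem' {x} hx := by
    simp only [Set.mem_ofPred_eq] at *
    rw [smul_neg, hx]

variable (M : Type u) [AddCommGroup M] [Module Λ M]

lemma smul_mem_part (m : M) : e • m ∈ part e he M := by
  change e • e • m = e • m
  rw [smul_smul, he]

lemma val_smul_mem_part (x : Corner e he) (m : M) : x.1 • m ∈ part e he M := by
  change e • x.1 • m = x.1 • m
  rw [smul_smul, x.2.1]

instance : Module (Corner e he) (part e he M) where
  smul x m := ⟨x.1 • m.1, val_smul_mem_part e he M x m.1⟩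
  one_smul m := Subtype.ext m.2
  mul_smul x y m := Subtype.ext (mul_smul x.1 y.1 m.1)
  smul_zero x := Subtype.ext (smul_zero x.1)
  smul_add x m n := Subtype.ext (smul_add x.1 m.1 n.1)
  add_smul x y m := Subtype.ext (add_smul x.1 y.1 m.1)
  zero_smul m := Subtype.ext (zero_smul Λ m.1)

@[simp] lemma coe_smul_part (x : Corner e he) (m : part e he M) :
    ((x • m : part e he M) : M) = x.1 • (m : M) := rfl

variable {M} {M' : Type u} [AddCommGroup M'] [Module Λ M']

/-- The restriction `eM → eM'` of a linear map `M → M'`. -/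
def partMap (φ : M →ₗ[Λ] M') : part e he M →ₗ[Corner e he] part e he M' where
  toFun m := ⟨φ m.1, by
    change e • φ m.1 = φ m.1
    rw [← map_smul, m.2]⟩
  map_add' m n := Subtype.ext (map_add φ m.1 n.1)
  map_smul' x m := Subtype.ext (map_smul φ x.1 m.1)

open CategoryTheory in
/-- The functor `M ↦ eM` from left modules over `Λ` to left modules over `eΛe`. -/
def partFunctor : ModuleCat.{u} Λ ⥤ ModuleCat.{u} (Corner e he) where
  obj M := ModuleCat.of _ (part e he M)
  map φ := ModuleCat.ofHom (partMap e he φ.hom)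

/-- An idempotent is full if the two-sided ideal it generates is the whole ring. -/
def IsFull (e : Λ) : Prop :=
  (1 : Λ) ∈ Submodule.span ℤ (Set.range fun p : Λ × Λ => p.1 * e * p.2)

variable {e}

lemma IsFull.exists_sum (h : IsFull e) :
    ∃ (s : Finset (Λ × Λ)) (c : Λ × Λ → Λ), ∑ p ∈ s, c p * e * p.2 = 1 := by
  obtain ⟨c, hc⟩ := Finsupp.mem_span_range_iff_exists_finsupp.1 h
  refine ⟨c.support, fun p => c p • p.1, ?_⟩
  rw [← hc]
  exact Finset.sum_congr rfl fun p _ => by simp only [smul_mul_assoc]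

lemma partMap_injective (h : IsFull e) :
    Injective (partMap e he : (M →ₗ[Λ] M') → _) := by
  obtain ⟨s, c, hc⟩ := h.exists_sum
  intro φ ψ hφψ
  ext m
  have key (n : M) : φ (e • n) = ψ (e • n) :=
    congrArg Subtype.val (LinearMap.congr_fun hφψ ⟨e • n, smul_mem_part e he M n⟩)
  rw [← one_smul Λ m, ← hc, Finset.sum_smul, map_sum, map_sum]
  exact Finset.sum_congr rfl fun p _ => by
    rw [mul_assoc, mul_smul, mul_smul, map_smul φ, map_smul ψ, key]

lemma partMap_surjective (h : IsFull e) :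
    Surjective (partMap e he : (M →ₗ[Λ] M') → _) := by
  obtain ⟨s, c, hc⟩ := h.exists_sum
  intro g
  have hcorner (x : Λ) (n : M) :
      (g ⟨e • (x * e) • n, smul_mem_part e he M _⟩ : M')
        = (e * x * e) • (g ⟨e • n, smul_mem_part e he M _⟩ : M') := by
    have := congrArg Subtype.val (g.map_smul
      (⟨e * x * e, by rw [← mul_assoc, ← mul_assoc, he], by rw [mul_assoc, he]⟩ : Corner e he)
      ⟨e • n, smul_mem_part e he M _⟩)
    refine Eq.trans ?_ this
    congr 2
    apply Subtype.ext
    change e • (x * e) • n = (e * x * e) • e • n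
    simp only [smul_smul, mul_assoc, he.eq]
  have hgadd (m n : M) : (g ⟨e • (m + n), smul_mem_part e he M _⟩ : M')
      = g ⟨e • m, smul_mem_part e he M _⟩ + g ⟨e • n, smul_mem_part e he M _⟩ := by
    rw [← AddSubgroup.coe_add, ← map_add]
    congr 2
    exact Subtype.ext (smul_add _ _ _)
  let γ : M →+ M' := AddMonoidHom.mk' (fun m => (g ⟨e • m, smul_mem_part e he M _⟩ : M')) hgadd
  have hγe (m : M') (n : M) : e • γ n = γ n := (g ⟨e • n, _⟩).2
  have hγ (x : Λ) (n : M) : γ ((x * e) • n) = (e * x) • γ n := by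
    rw [show γ ((x * e) • n) = (e * x * e) • γ n from hcorner x n, mul_smul, hγe 0]
  have hG (r : Λ) (m : M) : ∑ p ∈ s, c p • γ (p.2 • r • m) = r • ∑ p ∈ s, c p • γ (p.2 • m) := by
    have h1 (p : Λ × Λ) : γ (p.2 • r • m) = ∑ q ∈ s, (e * (p.2 * r * c q)) • γ (q.2 • m) := by
      conv_lhs => rw [← one_smul Λ m, ← hc]
      simp only [Finset.sum_smul, Finset.smul_sum, map_sum]
      refine Finset.sum_congr rfl fun q _ => ?_
      rw [← hγ, smul_smul, smul_smul, smul_smul]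
      simp only [mul_assoc]
    simp only [h1, Finset.smul_sum]
    rw [Finset.sum_comm]
    refine Finset.sum_congr rfl fun q _ => ?_
    simp only [smul_smul, ← Finset.sum_smul]
    congr 1
    simp only [← mul_assoc, ← Finset.sum_mul, hc, one_mul]
  refine ⟨⟨⟨fun m => ∑ p ∈ s, c p • γ (p.2 • m), fun m n => ?_⟩, fun r m => hG r m⟩, ?_⟩
  · simp only [smul_add, map_add, Finset.sum_add_distrib]
  · ext m
    change ∑ p ∈ s, c p • γ (p.2 • m.1) = (g m : M')
    have h2 (p : Λ × Λ) : c p • γ (p.2 • m.1) = (c p * e * p.2) • (g m : M') := by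
      have hm : γ m.1 = g m := congrArg (fun y => (g y : M')) (Subtype.ext m.2)
      have hme : e • (g m : M') = g m := (g m).2
      conv_lhs => rw [← show e • m.1 = m.1 from m.2, smul_smul, hγ, hm]
      rw [smul_smul, mul_assoc]
    simp only [h2, ← Finset.sum_smul, hc, one_smul]

variable (e) in
/-- The right `Λ`-structure on `eΛ` makes `Hom(eΛ, N)` a left `Λ`-module. -/
@[reducible] def coindModule (N : Type u) [AddCommGroup N] [Module (Corner e he) N] :
    Module Λ (part e he Λ →ₗ[Corner e he] N) where
  smul r g :=
    { toFun := fun x => g ⟨x.1 * r, by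
        change e * (x.1 * r) = x.1 * r
        rw [← mul_assoc]; exact congrArg (· * r) x.2⟩
      map_add' := fun x y => by
        rw [← map_add]; congr 1; exact Subtype.ext (add_mul _ _ _)
      map_smul' := fun x y => by
        rw [RingHom.id_apply, ← map_smul]; congr 1; exact Subtype.ext (mul_assoc _ _ _) }
  one_smul g := LinearMap.ext fun x => congrArg g (Subtype.ext (mul_one _))
  mul_smul r s g := LinearMap.ext fun x => congrArg g (Subtype.ext (mul_assoc _ _ _).symm)
  smul_zero r := rfl
  smul_add r g g' := rfl
  add_smul r s g := LinearMap.ext fun x => by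
    refine Eq.trans ?_ (map_add g _ _)
    exact congrArg g (Subtype.ext (mul_add _ _ _))
  zero_smul g := LinearMap.ext fun x => by
    refine Eq.trans ?_ (map_zero g)
    exact congrArg g (Subtype.ext (mul_zero _))

lemma exists_part_equiv (N : Type u) [AddCommGroup N] [Module (Corner e he) N] :
    letI := coindModule e he N
    Nonempty (part e he (part e he Λ →ₗ[Corner e he] N) ≃ₗ[Corner e he] N) := by
  let := coindModule e he N
  let e₁ : part e he Λ := ⟨e, he⟩
  have hval (r : Λ) (g : part e he Λ →ₗ[Corner e he] N) (x : part e he Λ) (y : part e he Λ)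
      (h : x.1 * r = y.1) : (r • g) x = g y := congrArg g (Subtype.ext h)
  have hfix (g : part e he (part e he Λ →ₗ[Corner e he] N)) (x y : part e he Λ)
      (h : x.1 * e = y.1) : g.1 x = g.1 y := by
    rw [← hval e g.1 x y h]
    exact (LinearMap.congr_fun g.2 x).symm
  let toC (x : part e he Λ) : Corner e he := ⟨x.1 * e, by
    rw [← mul_assoc]; exact congrArg (· * e) x.2, by rw [mul_assoc, he]⟩
  let F : part e he (part e he Λ →ₗ[Corner e he] N) →ₗ[Corner e he] N :=
    { toFun := fun g => g.1 e₁
      map_add' := fun _ _ => rfl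
      map_smul' := fun x g => by
        have h1 : (x • g).1 e₁ = g.1 (x • e₁) :=
          hval x.1 g.1 e₁ (x • e₁) (x.2.1.trans x.2.2.symm)
        rw [h1, map_smul]; rfl }
  refine ⟨LinearEquiv.ofBijective F ⟨?_, ?_⟩⟩
  · rw [injective_iff_map_eq_zero]
    intro g hg
    refine Subtype.ext (LinearMap.ext fun x => ?_)
    have h1 : g.1 x = g.1 (toC x • e₁) := hfix g _ _ (by
      change x.1 * e = x.1 * e * e
      rw [mul_assoc, he])
    rw [h1, map_smul, show g.1 e₁ = 0 from hg, smul_zero]; rfl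
  · intro n
    let g : part e he Λ →ₗ[Corner e he] N :=
      { toFun := fun x => toC x • n
        map_add' := fun x y => by
          rw [← add_smul]; congr 1; exact Subtype.ext (add_mul _ _ _)
        map_smul' := fun x y => by
          rw [RingHom.id_apply, ← mul_smul]; congr 1; exact Subtype.ext (mul_assoc _ _ _) }
    refine ⟨⟨g, LinearMap.ext fun x => ?_⟩, ?_⟩
    · change toC ⟨x.1 * e, _⟩ • n = toC x • n
      congr 1
      exact Subtype.ext (by change x.1 * e * e = x.1 * e; rw [mul_assoc, he])
    · change toC e₁ • n = n
      rw [show toC e₁ = 1 from Subtype.ext he, one_smul]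

open CategoryTheory in
/-- A full idempotent induces an equivalence of categories of left modules. -/
theorem isEquivalence_partFunctor (h : IsFull e) : (partFunctor e he).IsEquivalence where
  faithful := ⟨fun hφ => ModuleCat.hom_ext
    (partMap_injective he h (congrArg ModuleCat.Hom.hom hφ))⟩
  full := ⟨fun g => by
    obtain ⟨φ, hφ⟩ := partMap_surjective he h g.hom
    exact ⟨ModuleCat.ofHom φ, ModuleCat.hom_ext hφ⟩⟩
  essSurj := ⟨fun N => by
    let := coindModule e he N
    obtain ⟨E⟩ := exists_part_equiv he N
    exact ⟨ModuleCat.of Λ (part e he Λ →ₗ[Corner e he] N), ⟨E.toModuleIso⟩⟩⟩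

end LeftModules

variable {R : Type u} [Ring R] {e : R} (he : IsIdempotentElem e)

lemma _root_.IsIdempotentElem.mulOp (he : IsIdempotentElem e) : IsIdempotentElem (op e) :=
  congrArg op he

/-- The opposite of a corner ring is a corner of the opposite ring. -/
def opRingEquiv : Corner (op e) he.mulOp ≃+* (Corner e he)ᵐᵒᵖ where
  toFun x := op ⟨unop x.1, congrArg unop x.2.2, congrArg unop x.2.1⟩
  invFun x := ⟨op x.unop.1, congrArg op x.unop.2.2, congrArg op x.unop.2.1⟩
  left_inv _ := rfl
  right_inv _ := rfl
  map_add' _ _ := rfl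
  map_mul' _ _ := rfl

lemma IsFull.mulOp (h : IsFull e) : IsFull (op e) := by
  unfold IsFull at *
  have := Submodule.mem_map_of_mem (f := (opAddEquiv : R ≃+ Rᵐᵒᵖ).toAddMonoidHom.toIntLinearMap) h
  rw [Submodule.map_span] at this
  refine Submodule.span_mono ?_ this
  rintro _ ⟨_, ⟨p, rfl⟩, rfl⟩
  exact ⟨(op p.2, op p.1), congrArg op (mul_assoc _ _ _).symm⟩

theorem moritaEquiv (h : IsFull e) : MoritaEquiv R (Corner e he) := by
  have := isEquivalence_partFunctor he.mulOp h.mulOp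
  exact ⟨(partFunctor (op e) he.mulOp).asEquivalence.trans
    (ModuleCat.restrictScalarsEquivalenceOfRingEquiv (opRingEquiv he)).symm⟩

end Corner

theorem MoritaEquiv.trans_ringEquiv {R S S' : Type u} [Ring R] [Ring S] [Ring S']
    (h : MoritaEquiv R S) (φ : S ≃+* S') : MoritaEquiv R S' :=
  ⟨h.some.trans (ModuleCat.restrictScalarsEquivalenceOfRingEquiv (RingEquiv.op φ)).symm⟩

/-! ### Semisimple quotients and simple modules -/

section SimpleModules

variable {A : Type u} [Ring A]

/-- The Jacobson radical annihilates simple right modules. -/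
lemma op_smul_eq_zero_of_mem_jacobson {S : Type u} [AddCommGroup S] [Module Aᵐᵒᵖ S]
    [IsSimpleModule Aᵐᵒᵖ S] {T : Type u} [Ring T] {f : A →+* T}
    (hker : RingHom.ker f = (⊥ : Ideal A).jacobson) {x : A} (hx : f x = 0) (s : S) :
    op x • s = 0 := by
  have hquasi (y : A) (hy : f y = 0) : ∃ u : A, u * (1 - y) = 1 := by
    obtain ⟨u, hu⟩ := Ideal.exists_mul_sub_mem_of_sub_one_mem_jacobson (I := ⊥) (1 - y) (by
      rw [← hker, RingHom.mem_ker]; simp [hy])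
    exact ⟨u, sub_eq_zero.1 (by simpa using hu)⟩
  by_contra hne
  obtain ⟨a, ha⟩ := IsSimpleModule.toSpanSingleton_surjective Aᵐᵒᵖ hne s
  have hxa : f (x * a.unop) = 0 := by simp [hx]
  obtain ⟨u, hu⟩ := hquasi _ hxa
  obtain ⟨w, hw⟩ := hquasi (1 - u) (by
    have h1 := congrArg f hu
    simp only [map_mul, map_sub, map_one, hx, zero_mul, sub_zero, mul_one] at h1
    simp [h1])
  rw [sub_sub_cancel] at hw
  have hv : (1 - x * a.unop) * u = 1 := by
    rwa [← left_inv_eq_right_inv hw hu]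
  have hzero : op (1 - x * a.unop) • s = 0 := by
    rw [op_sub, sub_smul, op_mul, mul_smul, op_unop, op_one, one_smul, sub_eq_zero]
    exact ha.symm
  have hs : s = 0 := by
    rw [← one_smul Aᵐᵒᵖ s, ← op_one, ← hv, op_mul, mul_smul, hzero, smul_zero]
  exact hne (by rw [hs, smul_zero])

variable {T : Type u} [Ring T] [Module Aᵐᵒᵖ T] {f : A →+* T}

lemma isSemisimpleModule_of_surjective (hmod : ∀ (a : A) (t : T), op a • t = t * f a)
    (hsurj : Surjective f) (hss : IsSemisimpleRing T) : IsSemisimpleModule Aᵐᵒᵖ T := by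
  have : RingHomSurjective (RingHom.op f) :=
    ⟨fun t => ⟨op (hsurj t.unop).choose, congrArg op (hsurj t.unop).choose_spec⟩⟩
  let l : T →ₛₗ[RingHom.op f] Tᵐᵒᵖ :=
    { toFun := op
      map_add' := fun _ _ => rfl
      map_smul' := fun a t => by
        conv_lhs => rw [← op_unop a, hmod, op_mul]
        rfl }
  exact (l.isSemisimpleModule_iff_of_bijective opEquiv.bijective).2
    (inferInstanceAs (IsSemisimpleRing Tᵐᵒᵖ))

/-- Maps of right `A`-modules out of `T` are right `T`-linear. -/
lemma map_eq_map_one_mul (hmod : ∀ (a : A) (t : T), op a • t = t * f a)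
    (hsurj : Surjective f) (g : T →ₗ[Aᵐᵒᵖ] T) (t : T) : g t = g 1 * t := by
  obtain ⟨a, rfl⟩ := hsurj t
  rw [← hmod, ← map_smul, hmod, one_mul]

/-- A simple right module embeds into the semisimple quotient of a semilocal ring. -/
lemma exists_injective_of_isSimpleModule (hmod : ∀ (a : A) (t : T), op a • t = t * f a)
    (hsurj : Surjective f) (hss : IsSemisimpleRing T)
    (hker : RingHom.ker f = (⊥ : Ideal A).jacobson)
    (S : Type u) [AddCommGroup S] [Module Aᵐᵒᵖ S] [IsSimpleModule Aᵐᵒᵖ S] :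
    ∃ g : S →ₗ[Aᵐᵒᵖ] T, Injective g := by
  have := isSemisimpleModule_of_surjective hmod hsurj hss
  have := IsSimpleModule.nontrivial Aᵐᵒᵖ S
  obtain ⟨s, hs⟩ := exists_ne (0 : S)
  have hwd (a b : A) (h : f a = f b) : op a • s = op b • s := by
    rw [← sub_eq_zero, ← sub_smul, ← op_sub]
    exact op_smul_eq_zero_of_mem_jacobson hker (by rw [map_sub, h, sub_self]) s
  let σ := surjInv hsurj
  have hσ (t : T) : f (σ t) = t := surjInv_eq hsurj t
  let φ : T →ₗ[Aᵐᵒᵖ] S :=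
    { toFun := fun t => op (σ t) • s
      map_add' := fun t t' => by
        rw [← add_smul, ← op_add]
        exact hwd _ _ (by simp only [map_add, hσ])
      map_smul' := fun a t => by
        rw [RingHom.id_apply, smul_smul, ← op_unop a, ← op_mul]
        exact hwd _ _ (by simp only [hmod, map_mul, hσ]) }
  have hφ : Surjective φ := fun s' => by
    obtain ⟨a, ha⟩ := IsSimpleModule.toSpanSingleton_surjective Aᵐᵒᵖ hs s'
    refine ⟨f a.unop, ?_⟩
    rw [← ha]
    exact hwd _ _ (hσ _)
  obtain ⟨g, hg⟩ := IsSemisimpleModule.lifting_property φ hφ LinearMap.id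
  exact ⟨g, fun x y hxy => by
    simpa [hxy] using (LinearMap.congr_fun hg x).symm.trans
      ((congrArg φ hxy).trans (LinearMap.congr_fun hg y))⟩

variable {ι : Type u} {S : ι → Type u} [∀ i, AddCommGroup (S i)] [∀ i, Module Aᵐᵒᵖ (S i)]

/-- Embeddings of pairwise non-isomorphic simple modules are jointly injective. -/
lemma toModule_injective {R : Type u} [Ring R] {S : ι → Type u} [∀ i, AddCommGroup (S i)]
    [∀ i, Module R (S i)] [∀ i, IsSimpleModule R (S i)]
    (hne : ∀ i j, Nonempty (S i ≃ₗ[R] S j) → i = j) [DecidableEq ι]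
    {M : Type u} [AddCommGroup M] [Module R M] (g : ∀ i, S i →ₗ[R] M)
    (hg : ∀ i, Injective (g i)) : Injective (DirectSum.toModule R ι M g) := by
  let e (i : ι) : S i ≃ₗ[R] LinearMap.range (g i) := LinearEquiv.ofInjective (g i) (hg i)
  have hsimple (i : ι) : IsSimpleModule R (LinearMap.range (g i)) := .congr (e i).symm
  have hind : iSupIndep fun i => LinearMap.range (g i) := by
    intro i
    rw [disjoint_iff]
    by_contra hbot
    have hle : LinearMap.range (g i) ≤ ⨆ j, ⨆ _ : j ≠ i, LinearMap.range (g j) := by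
      rw [← inf_eq_left]
      exact ((isSimpleModule_iff_isAtom.1 (hsimple i)).le_iff.1 inf_le_left).resolve_left hbot
    have hle' : LinearMap.range (g i) ≤ sSup ((fun j => LinearMap.range (g j)) '' {j | j ≠ i}) := by
      rwa [sSup_image]
    have : ∀ m : ((fun j => LinearMap.range (g j)) '' {j | j ≠ i}), IsSimpleModule R m := by
      rintro ⟨_, j, -, rfl⟩
      exact hsimple j
    obtain ⟨_, ⟨j, hji, rfl⟩, ⟨E⟩⟩ := Submodule.linearEquiv_of_le_sSup (hs := hle')
    exact hji (hne j i ⟨(e j).trans (E.symm.trans (e i).symm)⟩)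
  have hcomp : (DirectSum.toModule R ι M g : (⨁ i, S i) → M) =
      (DFinsupp.lsum ℕ fun i => (LinearMap.range (g i)).subtype) ∘
        (DFinsupp.mapRange.linearEquiv e) := by
    suffices h : DirectSum.toModule R ι M g =
        (DFinsupp.lsum ℕ fun i => (LinearMap.range (g i)).subtype) ∘ₗ
          (DFinsupp.mapRange.linearEquiv e).toLinearMap by
      rw [h]; rfl
    refine DirectSum.linearMap_ext R fun i => LinearMap.ext fun x => ?_
    rw [LinearMap.comp_apply, DirectSum.toModule_lof]
    change g i x = (DFinsupp.lsum ℕ fun i => (LinearMap.range (g i)).subtype)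
      (DFinsupp.mapRange.linearEquiv e (DFinsupp.single i x))
    rw [DFinsupp.mapRange.linearEquiv_apply, DFinsupp.mapRange_single, DFinsupp.lsum_single]
    rfl
  rw [hcomp]
  exact hind.dfinsupp_lsum_injective.comp (LinearEquiv.injective _)

/-- The direct sum of the simple right modules is a direct summand of the semisimple quotient. -/
lemma exists_splitting (hfam : IsSimpleFamily A S)
    (hmod : ∀ (a : A) (t : T), op a • t = t * f a)
    (hsurj : Surjective f) (hss : IsSemisimpleRing T)
    (hker : RingHom.ker f = (⊥ : Ideal A).jacobson) :
    ∃ (Φ : Sbar A S →ₗ[Aᵐᵒᵖ] T) (r : T →ₗ[Aᵐᵒᵖ] Sbar A S), ∀ v, r (Φ v) = v := by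
  classical
  have := isSemisimpleModule_of_surjective hmod hsurj hss
  have := hfam.1
  choose g hg using fun i => exists_injective_of_isSimpleModule hmod hsurj hss hker (S i)
  obtain ⟨r, hr⟩ := IsSemisimpleModule.extension_property _
    (toModule_injective hfam.2.2 g hg) LinearMap.id
  exact ⟨_, r, LinearMap.congr_fun hr⟩

/-- The idempotent cutting out the image of the sum of all simple right modules is full. -/
lemma isFull_of_splitting (hfam : IsSimpleFamily A S)
    (hmod : ∀ (a : A) (t : T), op a • t = t * f a)
    (hsurj : Surjective f) (hss : IsSemisimpleRing T)
    (Φ : Sbar A S →ₗ[Aᵐᵒᵖ] T) (r : T →ₗ[Aᵐᵒᵖ] Sbar A S) (hr : ∀ v, r (Φ v) = v)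
    {ε : T} (hε : ∀ t, Φ (r t) = ε * t) : Corner.IsFull ε := by
  classical
  have := isSemisimpleModule_of_surjective hmod hsurj hss
  let I : Submodule ℤ T := Submodule.span ℤ (Set.range fun p : T × T => p.1 * ε * p.2)
  let J : Submodule Aᵐᵒᵖ T :=
    { I.toAddSubgroup with
      smul_mem' := fun a x hx => by
        change a • x ∈ I
        rw [← op_unop a, hmod]
        refine Submodule.span_induction (p := fun x _ => x * f a.unop ∈ I) ?_ ?_ ?_ ?_ hx
        · rintro _ ⟨p, rfl⟩
          exact Submodule.subset_span ⟨(p.1, p.2 * f a.unop), (mul_assoc _ _ _).symm⟩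
        · simp
        · intro x y _ _ hx hy
          rw [add_mul]; exact I.add_mem hx hy
        · intro n x _ hx
          rw [smul_mul_assoc]; exact I.smul_mem n hx }
  suffices h : J = ⊤ from (h ▸ Submodule.mem_top : (1 : T) ∈ J)
  rw [eq_top_iff, ← IsSemisimpleModule.sSup_simples_eq_top Aᵐᵒᵖ T]
  refine sSup_le fun N (hN : IsSimpleModule Aᵐᵒᵖ N) => ?_
  obtain ⟨i, ⟨E⟩⟩ := hfam.2.1 N _ _ hN
  let j : N →ₗ[Aᵐᵒᵖ] T := Φ ∘ₗ DirectSum.lof Aᵐᵒᵖ ι S i ∘ₗ E.toLinearMap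
  have hj : Injective j := (LeftInverse.injective hr).comp
    ((DirectSum.of_injective i).comp E.injective)
  obtain ⟨h, hh⟩ := IsSemisimpleModule.extension_property j hj N.subtype
  intro x hx
  have h1 : h (j ⟨x, hx⟩) = x := LinearMap.congr_fun hh ⟨x, hx⟩
  have h2 : j ⟨x, hx⟩ = ε * j ⟨x, hx⟩ := by
    rw [← hε]
    exact congrArg Φ (hr _).symm
  rw [map_eq_map_one_mul hmod hsurj, h2, ← mul_assoc] at h1
  exact Submodule.subset_span ⟨(_, _), h1⟩

end SimpleModules

/-! ### The corner of `Â` and the asymmetric cover -/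

section CornerHat

variable {A : Type u} [Ring A] {ι : Type u} {S : ι → Type u}
  [∀ i, AddCommGroup (S i)] [∀ i, Module Aᵐᵒᵖ (S i)]

/-- Endomorphisms of the sum of all simple modules are diagonal, by Schur's lemma. -/
lemma IsSimpleFamily.end_apply [DecidableEq ι] (hfam : IsSimpleFamily A S)
    (D : Sbar A S →ₗ[Aᵐᵒᵖ] Sbar A S) (v : Sbar A S) (i : ι) :
    D v i = D (DirectSum.lof Aᵐᵒᵖ ι S i (v i)) i := by
  have := hfam.1
  have h : DirectSum.component Aᵐᵒᵖ ι S i ∘ₗ D = DirectSum.component Aᵐᵒᵖ ι S i ∘ₗ D ∘ₗ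
      DirectSum.lof Aᵐᵒᵖ ι S i ∘ₗ DirectSum.component Aᵐᵒᵖ ι S i := by
    refine DirectSum.linearMap_ext Aᵐᵒᵖ fun j => ?_
    by_cases hij : j = i
    · subst hij
      refine LinearMap.ext fun s => ?_
      simp only [LinearMap.comp_apply, DirectSum.component.lof_self]
    · have h0 : DirectSum.component Aᵐᵒᵖ ι S i ∘ₗ D ∘ₗ DirectSum.lof Aᵐᵒᵖ ι S j = 0 :=
        (LinearMap.bijective_or_eq_zero _).resolve_left
          fun hb => hij (hfam.2.2 j i ⟨LinearEquiv.ofBijective _ hb⟩)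
      refine LinearMap.ext fun s => ?_
      have h1 : DirectSum.component Aᵐᵒᵖ ι S i (DirectSum.lof Aᵐᵒᵖ ι S j s) = 0 := by
        rw [DirectSum.component.of, dif_neg hij]
      simp only [LinearMap.comp_apply, h1, map_zero]
      exact LinearMap.congr_fun h0 s
  exact LinearMap.congr_fun h v

variable {T : Type u} [Ring T] [Module Aᵐᵒᵖ T] {f : A →+* T}

/-- The corner at `ε` is the product of the endomorphism rings of the simple right modules,
compatibly with the actions on `εT` and on `S̄`. -/
lemma exists_corner_ringEquiv (hfam : IsSimpleFamily A S)
    (hmod : ∀ (a : A) (t : T), op a • t = t * f a) (hsurj : Surjective f)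
    (Φ : Sbar A S →ₗ[Aᵐᵒᵖ] T) (r : T →ₗ[Aᵐᵒᵖ] Sbar A S) (hr : ∀ v, r (Φ v) = v)
    {ε : T} (hε : IsIdempotentElem ε) (hΦr : ∀ t, Φ (r t) = ε * t) :
    ∃ ρ : Corner ε hε ≃+* ∀ i, EndS A S i,
      ∀ (x : Corner ε hε) (t : T) (i : ι), r (x.1 * t) i = ρ x i (r t i) := by
  classical
  let L (x : T) : T →ₗ[Aᵐᵒᵖ] T :=
    { toFun := fun t => x * t
      map_add' := mul_add x
      map_smul' := fun a t => by
        rw [RingHom.id_apply, ← op_unop a, hmod, hmod, mul_assoc] }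
  let ρ₀ (x : T) (i : ι) : EndS A S i :=
    DirectSum.component Aᵐᵒᵖ ι S i ∘ₗ (r ∘ₗ L x ∘ₗ Φ) ∘ₗ DirectSum.lof Aᵐᵒᵖ ι S i
  have hρΦ (x : T) (v : Sbar A S) (i : ι) : r (x * Φ v) i = ρ₀ x i (v i) :=
    hfam.end_apply (r ∘ₗ L x ∘ₗ Φ) v i
  have hρ (x : Corner ε hε) (t : T) (i : ι) : r (x.1 * t) i = ρ₀ x.1 i (r t i) := by
    rw [← hρΦ, hΦr, ← mul_assoc, x.2.2]
  have hρlof (x : T) (i : ι) (s : S i) :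
      ρ₀ x i s = r (x * Φ (DirectSum.lof Aᵐᵒᵖ ι S i s)) i := rfl
  let ρ : Corner ε hε →+* ∀ i, EndS A S i :=
    { toFun := fun x => ρ₀ x.1
      map_one' := by
        funext i
        refine LinearMap.ext fun s => ?_
        change ρ₀ ε i s = s
        rw [hρlof, ← hΦr, hr, hr]
        exact DirectSum.component.lof_self (M := S) Aᵐᵒᵖ i s
      map_mul' := fun x y => by
        funext i
        refine LinearMap.ext fun s => ?_
        change ρ₀ (x.1 * y.1) i s = ρ₀ x.1 i (ρ₀ y.1 i s)
        rw [hρlof, mul_assoc]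
        exact hρ x _ i
      map_zero' := by
        funext i
        refine LinearMap.ext fun s => ?_
        change ρ₀ 0 i s = 0
        rw [hρlof, zero_mul, map_zero]; rfl
      map_add' := fun x y => by
        funext i
        refine LinearMap.ext fun s => ?_
        change ρ₀ (x.1 + y.1) i s = ρ₀ x.1 i s + ρ₀ y.1 i s
        rw [hρlof, add_mul, map_add]; rfl }
  have hinj : Injective ρ := by
    rw [injective_iff_map_eq_zero]
    intro x hx
    have h0 : r x.1 = 0 := by
      refine DFinsupp.ext fun i => ?_
      have h1 := hρ x 1 i
      rw [mul_one, show ρ₀ x.1 i = 0 from congrFun hx i] at h1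
      exact h1
    exact Subtype.ext (by rw [← x.2.1, ← hΦr, h0, map_zero]; rfl)
  have hsur : Surjective ρ := by
    intro φ
    let D : Sbar A S →ₗ[Aᵐᵒᵖ] Sbar A S := DFinsupp.mapRange.linearMap φ
    have hD (t : T) : Φ (D (r t)) = Φ (D (r 1)) * t :=
      map_eq_map_one_mul hmod hsurj (Φ ∘ₗ D ∘ₗ r) t
    have hrε : r ε = r 1 := by rw [← mul_one ε, ← hΦr, hr]
    refine ⟨⟨Φ (D (r 1)), by rw [← hΦr, hr], by rw [← hD, hrε]⟩, ?_⟩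
    funext i
    refine LinearMap.ext fun s => ?_
    change ρ₀ (Φ (D (r 1))) i s = φ i s
    rw [hρlof, ← hD, hr, hr]
    change DFinsupp.mapRange.linearMap φ (DFinsupp.single i s) i = φ i s
    rw [DFinsupp.mapRange.linearMap_apply, DFinsupp.mapRange_single, DFinsupp.single_eq_same]
  exact ⟨RingEquiv.ofBijective ρ ⟨hinj, hsur⟩, hρ⟩

variable [SMulCommClass (TrivSqZeroExt T T) Aᵐᵒᵖ T]

lemma isIdempotentElem_hat {ε : T} (hε : IsIdempotentElem ε) :
    IsIdempotentElem (⟨1, 0, TrivSqZeroExt.inl ε⟩ : Tri A (TrivSqZeroExt T T) T) := by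
  refine Tri.ext (mul_one _) ?_ ?_
  · simp
  · exact (TrivSqZeroExt.inl_mul T ε ε).symm.trans (congrArg _ hε)

lemma isFull_hat {ε : T} (h : Corner.IsFull ε) :
    Corner.IsFull (⟨1, 0, TrivSqZeroExt.inl ε⟩ : Tri A (TrivSqZeroExt T T) T) := by
  let j : T →+ Tri A (TrivSqZeroExt T T) T :=
    { toFun := fun t => ⟨0, 0, TrivSqZeroExt.inl t⟩
      map_zero' := by ext <;> simp
      map_add' := fun x y => by ext <;> simp }
  have h1 := Submodule.mem_map_of_mem (f := j.toIntLinearMap) h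
  rw [Submodule.map_span] at h1
  have h2 : (⟨0, 0, 1⟩ : Tri A (TrivSqZeroExt T T) T) ∈ Submodule.span ℤ (Set.range
      fun p : Tri A (TrivSqZeroExt T T) T × Tri A (TrivSqZeroExt T T) T =>
        p.1 * ⟨1, 0, TrivSqZeroExt.inl ε⟩ * p.2) := by
    refine Submodule.span_mono ?_ h1
    rintro _ ⟨_, ⟨p, rfl⟩, rfl⟩
    refine ⟨(j p.1, j p.2), ?_⟩
    ext <;> simp [j]
  have h3 : (⟨1, 0, 0⟩ : Tri A (TrivSqZeroExt T T) T) ∈ Submodule.span ℤ (Set.range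
      fun p : Tri A (TrivSqZeroExt T T) T × Tri A (TrivSqZeroExt T T) T =>
        p.1 * ⟨1, 0, TrivSqZeroExt.inl ε⟩ * p.2) :=
    Submodule.subset_span ⟨(⟨1, 0, 0⟩, ⟨1, 0, 0⟩), by ext <;> simp⟩
  unfold Corner.IsFull
  convert Submodule.add_mem _ h3 h2 using 1
  ext <;> simp

lemma mem_corner_hat_iff {ε : T} (x : Tri A (TrivSqZeroExt T T) T) :
    ((⟨1, 0, TrivSqZeroExt.inl ε⟩ : Tri A (TrivSqZeroExt T T) T) * x = x ∧
      x * (⟨1, 0, TrivSqZeroExt.inl ε⟩ : Tri A (TrivSqZeroExt T T) T) = x) ↔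
    ε * x.m = x.m ∧ (ε * x.b.fst = x.b.fst ∧ x.b.fst * ε = x.b.fst) ∧
      (ε * x.b.snd = x.b.snd ∧ x.b.snd * ε = x.b.snd) := by
  have hsm : (TrivSqZeroExt.inl ε : TrivSqZeroExt T T) • x.m = ε * x.m := rfl
  simp only [Tri.ext_iff, Tri.mul_a, Tri.mul_m, Tri.mul_b, one_mul, mul_one, smul_zero, zero_add,
    add_zero, op_one, one_smul, hsm, TrivSqZeroExt.ext_iff, TrivSqZeroExt.fst_mul,
    TrivSqZeroExt.snd_mul, TrivSqZeroExt.fst_inl, TrivSqZeroExt.snd_inl, smul_eq_mul,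
    op_smul_eq_mul, mul_zero]
  tauto

lemma exists_corner_hat_ringEquiv (Φ : Sbar A S →ₗ[Aᵐᵒᵖ] T) (r : T →ₗ[Aᵐᵒᵖ] Sbar A S)
    (hr : ∀ v, r (Φ v) = v) {ε : T} (hε : IsIdempotentElem ε) (hΦr : ∀ t, Φ (r t) = ε * t)
    (ρ : Corner ε hε ≃+* ∀ i, EndS A S i)
    (hρ : ∀ (x : Corner ε hε) (t : T) (i : ι), r (x.1 * t) i = ρ x i (r t i))
    (hε' : IsIdempotentElem (⟨1, 0, TrivSqZeroExt.inl ε⟩ : Tri A (TrivSqZeroExt T T) T)) :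
    Nonempty (Corner _ hε' ≃+* AsymCover A S) := by
  have hmem (x : Corner _ hε') := (mem_corner_hat_iff x.1).1 x.2
  exact ⟨{
    toFun := fun x => ⟨x.1.a, r x.1.m, fun i =>
      (ρ ⟨x.1.b.fst, (hmem x).2.1⟩ i, ρ ⟨x.1.b.snd, (hmem x).2.2⟩ i)⟩
    invFun := fun y => ⟨⟨y.a, Φ y.m, ((ρ.symm fun i => (y.b i).fst).1,
      (ρ.symm fun i => (y.b i).snd).1)⟩, (mem_corner_hat_iff _).2
        ⟨by rw [← hΦr, hr], (ρ.symm fun i => (y.b i).fst).2, (ρ.symm fun i => (y.b i).snd).2⟩⟩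
    left_inv := fun x => by
      refine Subtype.ext (Tri.ext rfl ?_ (TrivSqZeroExt.ext ?_ ?_))
      · exact (hΦr _).trans (hmem x).1
      · exact congrArg Subtype.val (ρ.symm_apply_apply _)
      · exact congrArg Subtype.val (ρ.symm_apply_apply _)
    right_inv := fun y => by
      refine Tri.ext rfl (hr _) (funext fun i => TrivSqZeroExt.ext ?_ ?_)
      · exact congrFun (ρ.apply_symm_apply fun i => (y.b i).fst) i
      · exact congrFun (ρ.apply_symm_apply fun i => (y.b i).snd) i
    map_add' := fun x y => by
      refine Tri.ext rfl (map_add r _ _) (funext fun i => TrivSqZeroExt.ext ?_ ?_)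
      · exact congrFun (map_add ρ ⟨x.1.b.fst, (hmem x).2.1⟩ ⟨y.1.b.fst, (hmem y).2.1⟩) i
      · exact congrFun (map_add ρ ⟨x.1.b.snd, (hmem x).2.2⟩ ⟨y.1.b.snd, (hmem y).2.2⟩) i
    map_mul' := fun x y => by
      refine Tri.ext rfl ?_ (funext fun i => TrivSqZeroExt.ext ?_ ?_)
      · refine DFinsupp.ext fun i => ?_
        change r (op y.1.a • x.1.m + x.1.b.fst * y.1.m) i =
          op y.1.a • r x.1.m i + ρ ⟨x.1.b.fst, (hmem x).2.1⟩ i (r y.1.m i)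
        rw [map_add, map_smul]
        exact congrArg (op y.1.a • r x.1.m i + ·) (hρ ⟨x.1.b.fst, (hmem x).2.1⟩ y.1.m i)
      · exact congrFun (map_mul ρ ⟨x.1.b.fst, (hmem x).2.1⟩ ⟨y.1.b.fst, (hmem y).2.1⟩) i
      · exact congrFun ((map_add ρ
          (⟨x.1.b.fst, (hmem x).2.1⟩ * ⟨y.1.b.snd, (hmem y).2.2⟩)
          (⟨x.1.b.snd, (hmem x).2.2⟩ * ⟨y.1.b.fst, (hmem y).2.1⟩)).trans
            (congrArg₂ (· + ·) (map_mul ρ _ _) (map_mul ρ _ _))) i }⟩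

end CornerHat

/-- Let `A` be a semilocal ring, presented by a surjection
`f : A → T` onto a semisimple ring `T` with kernel the Jacobson radical (so
`T = A/rad A`).  Then the ring `Â = [[A,0],[A/rad A, T(A/rad A)]]` is Morita
equivalent to the asymmetric cover `Ã = [[A,0],[S̄,Ā]]`: there is an
idempotent `ε ∈ A/rad A` inducing a Morita equivalence
`A/rad A ∼ ε(A/rad A)ε ≅ ∏_{S ∈ Σ(A)} End_A(S)`, and for
`ε̃ = [[1,0],[0,(ε,0)]]` one has `Â` Morita equivalent to `ε̃Âε̃ ≅ Ã`. -/
theorem hatCover_morita_asymCover_of_semilocal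
    (A : Type u) [Ring A] {ι : Type u} (S : ι → Type u)
    [∀ i, AddCommGroup (S i)] [∀ i, Module Aᵐᵒᵖ (S i)]
    (hfam : IsSimpleFamily A S)
    (T : Type u) [Ring T] (f : A →+* T) (hsurj : Function.Surjective f)
    (hss : IsSemisimpleRing T) (hker : RingHom.ker f = (⊥ : Ideal A).jacobson) :
    letI := hatModAop A T f
    letI := hatSMulComm A T f
    ∃ (ε : T) (hε : IsIdempotentElem ε),
      MoritaEquiv T (Corner ε hε) ∧
      Nonempty (Corner ε hε ≃+* ∀ i, EndS A S i) ∧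
      MoritaEquiv (Tri A (TrivSqZeroExt T T) T) (AsymCover A S) ∧
      ∃ hε' : IsIdempotentElem
          (⟨1, 0, TrivSqZeroExt.inl ε⟩ : Tri A (TrivSqZeroExt T T) T),
        MoritaEquiv (Tri A (TrivSqZeroExt T T) T) (Corner _ hε') ∧
        Nonempty (Corner _ hε' ≃+* AsymCover A S) := by
  let := hatModAop A T f
  have := hatSMulComm A T f
  have hmod (a : A) (t : T) : op a • t = t * f a := rfl
  obtain ⟨Φ, r, hr⟩ := exists_splitting hfam hmod hsurj hss hker
  have hΦr (t : T) : Φ (r t) = Φ (r 1) * t := map_eq_map_one_mul hmod hsurj (Φ ∘ₗ r) t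
  have hε : IsIdempotentElem (Φ (r 1)) := by
    rw [IsIdempotentElem, ← hΦr, hr]
  have hfull := isFull_of_splitting hfam hmod hsurj hss Φ r hr hΦr
  obtain ⟨ρ, hρ⟩ := exists_corner_ringEquiv hfam hmod hsurj Φ r hr hε hΦr
  have hε' := isIdempotentElem_hat (A := A) hε
  have hmorita := Corner.moritaEquiv hε' (isFull_hat hfull)
  obtain ⟨Ψ⟩ := exists_corner_hat_ringEquiv Φ r hr hε hΦr ρ hρ hε'
  exact ⟨_, hε, Corner.moritaEquiv hε hfull, ⟨ρ⟩, hmorita.trans_ringEquiv Ψ, hε', hmorita, ⟨Ψ⟩⟩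
end

section
/- Let A be a ring and Ã = [[A,0],[S̄,Ā]] its asymmetric cover. If A is right perfect then Ã is right perfect, and if A is left perfect then Ã is left perfect. -/
set_option linter.unusedSectionVars false
set_option synthInstance.maxHeartbeats 1000000
set_option maxHeartbeats 1600000
set_option linter.unusedVariables false
set_option linter.unnecessarySeqFocus false

universe u
open MulOpposite Function DirectSum

/-! ### Projective covers -/

/-- A superfluous epimorphism: a surjective linear map whose kernel is superfluous. -/
def IsSuperfluousEpi {R P M : Type u} [Ring R] [AddCommGroup P] [Module R P]
    [AddCommGroup M] [Module R M] (f : P →ₗ[R] M) : Prop :=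
  Function.Surjective f ∧ ∀ N : Submodule R P, N ⊔ LinearMap.ker f = ⊤ → N = ⊤

/-- The module `M` has a projective cover. -/
def HasProjCover (R M : Type u) [Ring R] [AddCommGroup M] [Module R M] : Prop :=
  ∃ (P : Type u) (_ : AddCommGroup P) (_ : Module R P) (f : P →ₗ[R] M),
    Module.Projective R P ∧ IsSuperfluousEpi f

section ProjCover
variable {R : Type u} [Ring R] {P M M' : Type u} [AddCommGroup P] [Module R P]
  [AddCommGroup M] [Module R M] [AddCommGroup M'] [Module R M']

lemma sup_ker_eq_top_iff {f : P →ₗ[R] M} {N : Submodule R P} :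
    N ⊔ LinearMap.ker f = ⊤ ↔ ∀ p, ∃ n ∈ N, f n = f p := by
  rw [eq_top_iff]
  constructor
  · intro h p
    obtain ⟨n, hn, k, hk, rfl⟩ := Submodule.mem_sup.1 (h (Submodule.mem_top (x := p)))
    exact ⟨n, hn, by simp [LinearMap.mem_ker.1 hk]⟩
  · intro h p _
    obtain ⟨n, hn, hnp⟩ := h p
    exact Submodule.mem_sup.2 ⟨n, hn, p - n, by simp [hnp], by simp⟩

lemma IsSuperfluousEpi.eq_top {f : P →ₗ[R] M} (hf : IsSuperfluousEpi f) {N : Submodule R P}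
    (h : ∀ p, ∃ n ∈ N, f n = f p) : N = ⊤ :=
  hf.2 N (sup_ker_eq_top_iff.2 h)

lemma isSuperfluousEpi_of {f : P →ₗ[R] M} (hs : Function.Surjective f)
    (h : ∀ N : Submodule R P, (∀ p, ∃ n ∈ N, f n = f p) → N = ⊤) : IsSuperfluousEpi f :=
  ⟨hs, fun N hN => h N (sup_ker_eq_top_iff.1 hN)⟩

lemma IsSuperfluousEpi.comp {g : M →ₗ[R] M'} {f : P →ₗ[R] M} (hg : IsSuperfluousEpi g)
    (hf : IsSuperfluousEpi f) : IsSuperfluousEpi (g ∘ₗ f) := by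
  refine isSuperfluousEpi_of (hg.1.comp hf.1) fun N hN => hf.eq_top fun p => ?_
  have : N.map f = ⊤ := hg.eq_top fun m => by
    obtain ⟨p, rfl⟩ := hf.1 m
    obtain ⟨n, hn, h⟩ := hN p
    exact ⟨f n, Submodule.mem_map_of_mem hn, h⟩
  exact Submodule.mem_map.1 (this ▸ Submodule.mem_top : f p ∈ N.map f)

lemma HasProjCover.of_superfluousEpi {q : M →ₗ[R] M'} (hq : IsSuperfluousEpi q)
    (h : HasProjCover R M') : HasProjCover R M := by
  obtain ⟨P, _, _, f, hP, hf⟩ := h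
  obtain ⟨g, hg⟩ := Module.projective_lifting_property q f hq.1
  have hg' : ∀ p, q (g p) = f p := fun p => by rw [← hg]; rfl
  refine ⟨P, _, _, g, hP, isSuperfluousEpi_of ?_ fun N hN => hf.eq_top fun p => ?_⟩
  · refine LinearMap.range_eq_top.1 (hq.eq_top fun m => ?_)
    obtain ⟨p, hp⟩ := hf.1 (q m)
    exact ⟨g p, ⟨p, rfl⟩, by rw [hg', hp]⟩
  · obtain ⟨n, hn, h⟩ := hN p
    exact ⟨n, hn, by rw [← hg', ← hg', h]⟩

lemma IsSuperfluousEpi.prodMap_id {f : P →ₗ[R] M} (hf : IsSuperfluousEpi f) :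
    IsSuperfluousEpi (f.prodMap (LinearMap.id : M' →ₗ[R] M')) := by
  refine isSuperfluousEpi_of (hf.1.prodMap Function.surjective_id) fun N hN => ?_
  have htop : N.comap (LinearMap.inl R P M') = ⊤ := hf.eq_top fun p => by
    obtain ⟨⟨n, n'⟩, hn, h⟩ := hN (p, 0)
    obtain ⟨h1, h2⟩ := Prod.ext_iff.1 h
    obtain rfl : n' = 0 := h2
    exact ⟨n, hn, h1⟩
  refine eq_top_iff.2 fun p _ => ?_
  obtain ⟨n, hn, h⟩ := hN p
  have hk : (p.1 - n.1, (0 : M')) ∈ N :=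
    (htop ▸ Submodule.mem_top : p.1 - n.1 ∈ N.comap (LinearMap.inl R P M'))
  have h2 : n.2 = p.2 := (Prod.ext_iff.1 h).2
  convert N.add_mem hk hn using 1
  ext <;> simp [h2]

lemma IsSuperfluousEpi.id_prodMap {f : P →ₗ[R] M} (hf : IsSuperfluousEpi f) :
    IsSuperfluousEpi ((LinearMap.id : M' →ₗ[R] M').prodMap f) := by
  refine isSuperfluousEpi_of (Function.surjective_id.prodMap hf.1) fun N hN => ?_
  have htop : N.comap (LinearMap.inr R M' P) = ⊤ := hf.eq_top fun p => by
    obtain ⟨⟨n', n⟩, hn, h⟩ := hN (0, p)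
    obtain ⟨h2, h1⟩ := Prod.ext_iff.1 h
    obtain rfl : n' = 0 := h2
    exact ⟨n, hn, h1⟩
  refine eq_top_iff.2 fun p _ => ?_
  obtain ⟨n, hn, h⟩ := hN p
  have hk : ((0 : M'), p.2 - n.2) ∈ N :=
    (htop ▸ Submodule.mem_top : p.2 - n.2 ∈ N.comap (LinearMap.inr R M' P))
  have h2 : n.1 = p.1 := (Prod.ext_iff.1 h).1
  convert N.add_mem hk hn using 1
  ext <;> simp [h2]

lemma HasProjCover.prod (h : HasProjCover R M) (h' : HasProjCover R M') :
    HasProjCover R (M × M') := by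
  obtain ⟨P, _, _, f, hP, hf⟩ := h
  obtain ⟨P', _, _, f', hP', hf'⟩ := h'
  exact ⟨P × P', _, _, _, inferInstance, hf'.id_prodMap.comp hf.prodMap_id⟩

lemma IsSuperfluousEpi.of_bijective {f : P →ₗ[R] M} (hf : Function.Bijective f) :
    IsSuperfluousEpi f :=
  ⟨hf.2, fun N hN => by rwa [LinearMap.ker_eq_bot.2 hf.1, sup_bot_eq] at hN⟩

/-- Superfluous epimorphisms are preserved by restriction of scalars along a surjection. -/
lemma IsSuperfluousEpi.restrictScalars {T : Type u} [Ring T] [Module T P] [Module T M]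
    {q : R →+* T} (hq : Function.Surjective q) (hP : ∀ (r : R) (p : P), q r • p = r • p)
    {f : P →ₗ[T] M} {g : P →ₗ[R] M} (hfg : ∀ p, g p = f p)
    (hf : IsSuperfluousEpi f) : IsSuperfluousEpi g := by
  refine isSuperfluousEpi_of (fun m => ?_) fun N hN => ?_
  · obtain ⟨p, hp⟩ := hf.1 m
    exact ⟨p, by rw [hfg, hp]⟩
  let N' : Submodule T P :=
    { N.toAddSubgroup with
      smul_mem' := fun t p hp => by
        obtain ⟨r, rfl⟩ := hq t
        rw [hP]
        exact N.smul_mem r hp }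
  have : N' = ⊤ := hf.eq_top fun p => by
    obtain ⟨n, hn, h⟩ := hN p
    exact ⟨n, hn, by rw [← hfg, ← hfg, h]⟩
  exact eq_top_iff.2 fun p _ => (this ▸ Submodule.mem_top : p ∈ N')

/-- A module killed by the kernel of a surjective ring homomorphism is a module over the
codomain. -/
lemma exists_module_of_ker_smul {R T M : Type u} [Ring R] [Ring T] [AddCommGroup M] [Module R M]
    (q : R →+* T) (hq : Function.Surjective q)
    (h : ∀ r : R, q r = 0 → ∀ m : M, r • m = 0) :
    ∃ _ : Module T M, ∀ (r : R) (m : M), q r • m = r • m := by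
  let _ : SMul T M := ⟨fun t m => Function.surjInv hq t • m⟩
  have key : ∀ (r : R) (m : M), q r • m = r • m := fun r m => by
    change Function.surjInv hq (q r) • m = r • m
    rw [← sub_eq_zero, ← sub_smul]
    exact h _ (by simp [Function.surjInv_eq hq]) m
  exact ⟨hq.moduleLeft q key, key⟩

/-- If a left perfect quotient ring `T` of `R` is projective as an `R`-module, then every
`T`-module has a projective cover over `R`. -/
lemma HasProjCover.of_projective_quotient {T : Type u} [Ring T] (hT : IsLeftPerfect T)
    (q : R →+* T) (hq : Function.Surjective q)
    (hproj : @Module.Projective R _ T _ (Module.compHom T q))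
    (h : ∀ r : R, q r = 0 → ∀ m : M, r • m = 0) : HasProjCover R M := by
  obtain ⟨_, hM⟩ := exists_module_of_ker_smul q hq h
  obtain ⟨P, _, _, f, hP, hf⟩ := hT M _ _
  let _ : Module R T := Module.compHom T q
  let _ : Module R P := Module.compHom P q
  have : IsScalarTower R T P := ⟨fun r t p => mul_smul (q r) t p⟩
  obtain ⟨s, hs⟩ := hP.out
  refine ⟨P, _, _, { f with map_smul' := fun r p => ?_ }, ?_,
    IsSuperfluousEpi.restrictScalars hq (fun r p => rfl) (fun p => rfl) hf⟩
  · exact (f.map_smul (q r) p).trans (hM r _)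
  · have : Module.Projective R T := hproj
    have : Module.Projective R (P →₀ T) := by
      classical exact .of_equiv (finsuppLequivDFinsupp R).symm
    refine Module.Projective.of_split (M := P →₀ T) (R := R)
      { s with map_smul' := fun r p => ?_ }
      { Finsupp.linearCombination T id with map_smul' := fun r p => ?_ } ?_
    · exact s.map_smul (q r) p
    · exact (Finsupp.linearCombination T id).map_smul (q r) p
    · ext p
      exact hs p

/-- Multiplication by a central element, as a linear endomorphism. -/
def centralSMul (M : Type u) [AddCommGroup M] [Module R M] (e : R) (he : ∀ r, e * r = r * e) :
    M →ₗ[R] M where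
  toFun m := e • m
  map_add' := smul_add e
  map_smul' r m := by rw [← mul_smul, he, mul_smul]; rfl

lemma isLeftPerfect_prod {R₁ R₂ : Type u} [Ring R₁] [Ring R₂] (h₁ : IsLeftPerfect R₁)
    (h₂ : IsLeftPerfect R₂) : IsLeftPerfect (R₁ × R₂) := by
  intro M _ _
  have he₁ : ∀ r : R₁ × R₂, (1, 0) * r = r * (1, 0) := fun r => by ext <;> simp
  have he₂ : ∀ r : R₁ × R₂, (0, 1) * r = r * (0, 1) := fun r => by ext <;> simp
  let φ₁ := centralSMul M ((1, 0) : R₁ × R₂) he₁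
  let φ₂ := centralSMul M ((0, 1) : R₁ × R₂) he₂
  have hφ₁ : ∀ m, φ₂ (φ₁ m) = 0 := fun m => by
    change ((0, 1) : R₁ × R₂) • ((1, 0) : R₁ × R₂) • m = 0
    rw [← mul_smul, show ((0, 1) : R₁ × R₂) * (1, 0) = 0 by ext <;> simp, zero_smul]
  have hφ₂ : ∀ m, φ₁ (φ₂ m) = 0 := fun m => by
    change ((1, 0) : R₁ × R₂) • ((0, 1) : R₁ × R₂) • m = 0
    rw [← mul_smul, show ((1, 0) : R₁ × R₂) * (0, 1) = 0 by ext <;> simp, zero_smul]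
  have hφ : ∀ m, φ₁ m + φ₂ m = m := fun m => by
    change ((1, 0) : R₁ × R₂) • m + ((0, 1) : R₁ × R₂) • m = m
    rw [← add_smul, show ((1, 0) : R₁ × R₂) + (0, 1) = 1 by ext <;> simp, one_smul]
  have c₁ : HasProjCover (R₁ × R₂) (LinearMap.ker φ₂) := by
    refine HasProjCover.of_projective_quotient h₁ (RingHom.fst R₁ R₂) Prod.fst_surjective ?_ ?_
    · let _ : Module (R₁ × R₂) R₁ := Module.compHom R₁ (RingHom.fst R₁ R₂)
      refine Module.Projective.of_split (P := R₁) (M := R₁ × R₂) (R := R₁ × R₂)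
        { toFun := fun x => (x, 0), map_add' := fun x y => by simp, map_smul' := fun r x => ?_ }
        { toFun := Prod.fst, map_add' := fun x y => rfl, map_smul' := fun r x => rfl } ?_
      · exact Prod.ext rfl (mul_zero _).symm
      · exact LinearMap.ext fun _ => rfl
    · rintro ⟨a, b⟩ hab ⟨m, hm⟩
      obtain rfl : a = 0 := hab
      apply Subtype.ext
      change ((0, b) : R₁ × R₂) • m = 0
      rw [show ((0, b) : R₁ × R₂) = (0, b) * (0, 1) by ext <;> simp, mul_smul,
        show ((0, 1) : R₁ × R₂) • m = 0 from hm, smul_zero]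
  have c₂ : HasProjCover (R₁ × R₂) (LinearMap.ker φ₁) := by
    refine HasProjCover.of_projective_quotient h₂ (RingHom.snd R₁ R₂) Prod.snd_surjective ?_ ?_
    · let _ : Module (R₁ × R₂) R₂ := Module.compHom R₂ (RingHom.snd R₁ R₂)
      refine Module.Projective.of_split (P := R₂) (M := R₁ × R₂) (R := R₁ × R₂)
        { toFun := fun x => (0, x), map_add' := fun x y => by simp, map_smul' := fun r x => ?_ }
        { toFun := Prod.snd, map_add' := fun x y => rfl, map_smul' := fun r x => rfl } ?_
      · exact Prod.ext (mul_zero _).symm rfl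
      · exact LinearMap.ext fun _ => rfl
    · rintro ⟨a, b⟩ hab ⟨m, hm⟩
      obtain rfl : b = 0 := hab
      apply Subtype.ext
      change ((a, 0) : R₁ × R₂) • m = 0
      rw [show ((a, 0) : R₁ × R₂) = (a, 0) * (1, 0) by ext <;> simp, mul_smul,
        show ((1, 0) : R₁ × R₂) • m = 0 from hm, smul_zero]
  let ψ : M →ₗ[R₁ × R₂] LinearMap.ker φ₂ × LinearMap.ker φ₁ :=
    (φ₁.codRestrict _ fun m => LinearMap.mem_ker.2 (hφ₁ m)).prod
      (φ₂.codRestrict _ fun m => LinearMap.mem_ker.2 (hφ₂ m))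
  refine HasProjCover.of_superfluousEpi (q := ψ) (.of_bijective ⟨fun x y hxy => ?_, fun x => ?_⟩)
    (c₁.prod c₂)
  · have h1 : φ₁ x = φ₁ y := congrArg Subtype.val (Prod.ext_iff.1 hxy).1
    have h2 : φ₂ x = φ₂ y := congrArg Subtype.val (Prod.ext_iff.1 hxy).2
    rw [← hφ x, ← hφ y, h1, h2]
  · obtain ⟨⟨x, hx⟩, ⟨y, hy⟩⟩ := x
    have hx' := hφ x
    have hy' := hφ y
    rw [LinearMap.mem_ker] at hx hy
    rw [hx, add_zero] at hx'
    rw [hy, zero_add] at hy'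
    refine ⟨x + y, Prod.ext (Subtype.ext ?_) (Subtype.ext ?_)⟩
    · change φ₁ (x + y) = x
      rw [map_add, hx', hy, add_zero]
    · change φ₂ (x + y) = y
      rw [map_add, hx, hy', zero_add]

/-! ### Square-zero extensions -/

/-- If `I` is a two-sided ideal of square zero, then an epimorphism from `M` whose kernel is
contained in `I • M` is superfluous. -/
lemma isSuperfluousEpi_of_ker_le {T : Type u} [Ring T] (q : R →+* T)
    (hsq : ∀ x y : R, q x = 0 → q y = 0 → x * y = 0) {f : M →ₗ[R] M'}
    (hf : Function.Surjective f)
    (hker : LinearMap.ker f ≤ Submodule.span R {x | ∃ r, q r = 0 ∧ ∃ m : M, r • m = x}) :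
    IsSuperfluousEpi f := by
  refine isSuperfluousEpi_of hf fun N hN => ?_
  have key : ∀ p, ∃ n ∈ N,
      p - n ∈ Submodule.span R {x | ∃ r, q r = 0 ∧ ∃ m : M, r • m = x} := fun p => by
    obtain ⟨n, hn, h⟩ := hN p
    exact ⟨n, hn, hker (by simp [h])⟩
  have hkill : ∀ r, q r = 0 →
      ∀ x ∈ Submodule.span R {x | ∃ r, q r = 0 ∧ ∃ m : M, r • m = x}, r • x = 0 := by
    intro r hr x hx
    induction hx using Submodule.span_induction generalizing r with
    | mem x hx =>
      obtain ⟨r', hr', m, rfl⟩ := hx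
      rw [← mul_smul, hsq r r' hr hr', zero_smul]
    | zero => exact smul_zero r
    | add x y _ _ hx hy => rw [smul_add, hx r hr, hy r hr, add_zero]
    | smul a x _ hx => rw [← mul_smul]; exact hx _ (by simp [hr])
  have hle : Submodule.span R {x | ∃ r, q r = 0 ∧ ∃ m : M, r • m = x} ≤ N := by
    refine Submodule.span_le.2 ?_
    rintro _ ⟨r, hr, m, rfl⟩
    obtain ⟨n, hn, h⟩ := key m
    have : r • m = r • n := by
      rw [← sub_eq_zero, ← smul_sub]
      exact hkill r hr _ h
    rw [SetLike.mem_coe, this]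
    exact N.smul_mem r hn
  refine eq_top_iff.2 fun p _ => ?_
  obtain ⟨n, hn, h⟩ := key p
  simpa using N.add_mem (hle h) hn

/-- Newton's step for lifting idempotents modulo a square-zero ideal. -/
lemma isIdempotentElem_of_mul_self_sub_self_sq_eq_zero {E : Type u} [Ring E] (a : E)
    (h : (a * a - a) * (a * a - a) = 0) :
    IsIdempotentElem (3 • (a * a) - 2 • (a * a * a)) := by
  have key : (3 • (a * a) - 2 • (a * a * a)) * (3 • (a * a) - 2 • (a * a * a)) -
      (3 • (a * a) - 2 • (a * a * a)) =
      (a * a - a) * (a * a - a) * (4 • (a * a) - 4 • a - 3 • (1 : E)) := by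
    noncomm_ring
  rw [h, zero_mul] at key
  exact sub_eq_zero.1 key

/-- A projective module over the quotient by a square-zero ideal has a projective cover over the
ring itself. -/
lemma HasProjCover.of_projective_squareZero {T : Type u} [Ring T] [Module T P] (q : R →+* T)
    (hq : Function.Surjective q) (hsq : ∀ x y : R, q x = 0 → q y = 0 → x * y = 0)
    (hP : ∀ (r : R) (p : P), q r • p = r • p) [Module.Projective T P] :
    HasProjCover R P := by
  obtain ⟨s, hs⟩ := (inferInstance : Module.Projective T P).out
  let _ : Module R T := Module.compHom T q
  have hqs : ∀ (r : R) (t : T), q r * t = r • t := fun r t => rfl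
  have : IsScalarTower R T P := ⟨fun r t p => by rw [← hqs, mul_smul, hP]⟩
  let qL : R →ₗ[R] T :=
    { toFun := q, map_add' := map_add q, map_smul' := fun r x => map_mul q r x }
  -- `π` reduces coefficients, `l` and `s'` are the canonical presentation and its section
  let π : (P →₀ R) →ₗ[R] (P →₀ T) := Finsupp.mapRange.linearMap qL
  have hπ : Function.Surjective π := Finsupp.mapRange_surjective _ (map_zero q) hq
  let l : (P →₀ T) →ₗ[R] P :=
    { Finsupp.linearCombination T (id : P → P) with
      map_smul' := fun r x => by
        have : r • x = q r • x := by ext; rfl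
        rw [this]
        exact ((Finsupp.linearCombination T (id : P → P)).map_smul (q r) x).trans (hP r _) }
  let s' : P →ₗ[R] (P →₀ T) :=
    { s with
      map_smul' := fun r x => by
        rw [← hP]
        exact s.map_smul (q r) x }
  have hls : ∀ p, l (s' p) = p := hs
  obtain ⟨e₀, he₀⟩ := Module.projective_lifting_property π (s' ∘ₗ l ∘ₗ π) hπ
  have he₀' : ∀ x, π (e₀ x) = s' (l (π x)) := fun x => by
    rw [← LinearMap.comp_apply, he₀]; rfl
  have hkerπ : ∀ x, π x = 0 → x ∈
      Submodule.span R {x | ∃ r, q r = 0 ∧ ∃ m : P →₀ R, r • m = x} := fun x hx => by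
    rw [← Finsupp.sum_single x]
    refine Submodule.sum_mem _ fun p _ => Submodule.subset_span ⟨x p, ?_, Finsupp.single p 1, ?_⟩
    · exact DFunLike.congr_fun hx p
    · simp
  -- endomorphisms with values in the kernel of reduction kill that kernel
  have hdd : ∀ d : Module.End R (P →₀ R), (∀ x, π (d x) = 0) → d * d = 0 := by
    intro d hd
    ext1 x
    have hkill : ∀ y, π y = 0 → d y = 0 := by
      intro y hy
      rw [← Finsupp.sum_single y, map_finsuppSum]
      refine Finset.sum_eq_zero fun p _ => ?_
      have h1 : Finsupp.single p (y p) = y p • Finsupp.single p (1 : R) := by simp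
      change d (Finsupp.single p (y p)) = 0
      rw [h1, map_smul]
      ext z
      exact hsq _ _ (DFunLike.congr_fun hy p) (DFunLike.congr_fun (hd (Finsupp.single p 1)) z)
    exact LinearMap.ext fun y => by exact hkill _ (hd _)
  have hd0 : (e₀ * e₀ - e₀) * (e₀ * e₀ - e₀) = 0 := hdd _ fun x => by
    change π (e₀ (e₀ x) - e₀ x) = 0
    rw [map_sub, he₀', he₀', hls, sub_self]
  let e : Module.End R (P →₀ R) := 3 • (e₀ * e₀) - 2 • (e₀ * e₀ * e₀)
  have he : ∀ x, e (e x) = e x := by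
    have : e * e = e := isIdempotentElem_of_mul_self_sub_self_sq_eq_zero e₀ hd0
    exact fun x => LinearMap.congr_fun this x
  have hπe : ∀ x, π (e x) = s' (l (π x)) := fun x => by
    have h : e x = (3 : R) • e₀ (e₀ x) - (2 : R) • e₀ (e₀ (e₀ x)) := by
      simp [e, ofNat_smul_eq_nsmul]
    rw [h, map_sub, map_smul, map_smul]
    simp only [he₀', hls]
    rw [← sub_smul]
    norm_num
  let F := LinearMap.range e
  have hF : ∀ p ∈ F, e p = p := by
    rintro _ ⟨x, rfl⟩
    exact he x
  refine ⟨F, _, _, l ∘ₗ π ∘ₗ F.subtype, ?_, isSuperfluousEpi_of_ker_le q hsq (fun p => ?_) ?_⟩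
  · exact Module.Projective.of_split F.subtype e.rangeRestrict
      (LinearMap.ext fun p => Subtype.ext (hF p p.2))
  · obtain ⟨x, hx⟩ := hπ (s' p)
    refine ⟨⟨e x, x, rfl⟩, ?_⟩
    change l (π (e x)) = p
    rw [hπe, hx, hls, hls]
  · rintro ⟨p, hpF⟩ hp
    have h1 : l (π p) = 0 := hp
    have h2 : π p = 0 := by rw [← hF p hpF, hπe, h1, map_zero]
    have h3 := Submodule.mem_map_of_mem (f := e.rangeRestrict) (hkerπ p h2)
    rw [show e.rangeRestrict p = ⟨p, hpF⟩ from Subtype.ext (hF p hpF), Submodule.map_span] at h3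
    refine Submodule.span_mono ?_ h3
    rintro _ ⟨_, ⟨r, hr, m, rfl⟩, rfl⟩
    exact ⟨r, hr, e.rangeRestrict m, (map_smul _ r m).symm⟩

/-- Left perfectness lifts along square-zero extensions. -/
lemma IsLeftPerfect.of_squareZero {T : Type u} [Ring T] (hT : IsLeftPerfect T) (q : R →+* T)
    (hq : Function.Surjective q) (hsq : ∀ x y : R, q x = 0 → q y = 0 → x * y = 0) :
    IsLeftPerfect R := by
  intro M _ _
  let K : Submodule R M := Submodule.span R {x | ∃ r, q r = 0 ∧ ∃ m : M, r • m = x}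
  have hK : IsSuperfluousEpi K.mkQ :=
    isSuperfluousEpi_of_ker_le q hsq K.mkQ_surjective (by rw [K.ker_mkQ])
  refine HasProjCover.of_superfluousEpi hK ?_
  obtain ⟨_, hM⟩ := exists_module_of_ker_smul (M := M ⧸ K) q hq fun r hr m => by
    obtain ⟨m, rfl⟩ := K.mkQ_surjective m
    rw [← map_smul, ← LinearMap.mem_ker, K.ker_mkQ]
    exact Submodule.subset_span ⟨r, hr, m, rfl⟩
  obtain ⟨P, _, _, f, hP, hf⟩ := hT (M ⧸ K) _ _
  let _ : Module R P := Module.compHom P q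
  let f' : P →ₗ[R] M ⧸ K :=
    { f with map_smul' := fun r p => (f.map_smul (q r) p).trans (hM r _) }
  obtain ⟨P', _, _, g, hP', hg⟩ :=
    HasProjCover.of_projective_squareZero (P := P) q hq hsq (fun r p => rfl)
  exact ⟨P', _, _, f' ∘ₗ g, hP',
    (IsSuperfluousEpi.restrictScalars hq (fun r p => rfl) (g := f') (fun p => rfl) hf).comp hg⟩

end ProjCover

/-! ### Perfect rings are semilocal -/

section Semilocal
variable {R : Type u} [Ring R]

lemma IsSuperfluousEpi.apply_mem_jacobson {P M : Type u} [AddCommGroup P] [Module R P]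
    [AddCommGroup M] [Module R M] {f : P →ₗ[R] M} (hf : IsSuperfluousEpi f) (φ : P →ₗ[R] R)
    {x : P} (hx : f x = 0) : φ x ∈ Ring.jacobson R := by
  refine Submodule.mem_sInf.2 fun m hm => ?_
  by_contra hxm
  have htop : m ⊔ Submodule.span R {φ x} = ⊤ := hm.2 _ (by simpa using hxm)
  have : m.comap φ = ⊤ := hf.eq_top fun p => by
    obtain ⟨a, ha, b, hb, hab⟩ := Submodule.mem_sup.1 (htop ▸ Submodule.mem_top :
      φ p ∈ m ⊔ Submodule.span R {φ x})
    obtain ⟨r, rfl⟩ := Submodule.mem_span_singleton.1 hb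
    refine ⟨p - r • x, ?_, by simp [hx]⟩
    rw [Submodule.mem_comap, map_sub, map_smul, ← hab, add_sub_cancel_right]
    exact ha
  exact hxm (this ▸ Submodule.mem_top : x ∈ m.comap φ)

/-- A left perfect ring is semisimple modulo its Jacobson radical. -/
lemma IsLeftPerfect.isSemisimpleRing_quotient (h : IsLeftPerfect R) :
    IsSemisimpleRing (R ⧸ Ring.jacobson R) := by
  have hss : IsSemisimpleModule R (R ⧸ Ring.jacobson R) := by
    refine (isSemisimpleModule_iff _ _).2 ⟨fun N => ?_⟩
    obtain ⟨P, _, _, f, hP, hf⟩ := h ((R ⧸ Ring.jacobson R) ⧸ N) _ _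
    obtain ⟨g, hg⟩ := Module.projective_lifting_property N.mkQ f N.mkQ_surjective
    have hker : LinearMap.ker f ≤ LinearMap.ker g := fun x hx => by
      obtain ⟨s, hs⟩ := hP.out
      rw [LinearMap.mem_ker, ← hs x, Finsupp.linearCombination_apply, map_finsuppSum]
      refine Finset.sum_eq_zero fun p _ => ?_
      have hj : s x p ∈ Ring.jacobson R :=
        IsSuperfluousEpi.apply_mem_jacobson hf (Finsupp.lapply p ∘ₗ s) hx
      change g (s x p • p) = 0
      rw [map_smul]
      obtain ⟨r, hr⟩ := Ideal.Quotient.mk_surjective (g p)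
      rw [← hr]
      exact Ideal.Quotient.eq_zero_iff_mem.2 (Ideal.mul_mem_right r _ hj)
    let k : ((R ⧸ Ring.jacobson R) ⧸ N) →ₗ[R] (R ⧸ Ring.jacobson R) :=
      (LinearMap.ker f).liftQ g hker ∘ₗ (f.quotKerEquivOfSurjective hf.1).symm.toLinearMap
    have hk : ∀ y, N.mkQ (k y) = y := fun y => by
      obtain ⟨p, rfl⟩ := hf.1 y
      have : (f.quotKerEquivOfSurjective hf.1).symm (f p) = (LinearMap.ker f).mkQ p := by
        rw [LinearEquiv.symm_apply_eq]; rfl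
      change N.mkQ ((LinearMap.ker f).liftQ g hker
        ((f.quotKerEquivOfSurjective hf.1).symm (f p))) = _
      rw [this]
      exact LinearMap.congr_fun hg p
    have hid : IsIdempotentElem (k ∘ₗ N.mkQ : Module.End R (R ⧸ Ring.jacobson R)) :=
      LinearMap.ext fun y => congrArg k (hk (N.mkQ y))
    refine ⟨LinearMap.range (k ∘ₗ N.mkQ), ?_⟩
    have hc := LinearMap.IsIdempotentElem.isCompl hid
    have : LinearMap.ker (k ∘ₗ N.mkQ) = N := by
      rw [LinearMap.ker_comp_of_ker_eq_bot _ (LinearMap.ker_eq_bot.2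
        (Function.LeftInverse.injective hk)), Submodule.ker_mkQ]
    rw [this] at hc
    exact hc.symm
  have : RingHomSurjective (Ideal.Quotient.mk (Ring.jacobson R)) := ⟨Ideal.Quotient.mk_surjective⟩
  let e : (R ⧸ Ring.jacobson R) →ₛₗ[Ideal.Quotient.mk (Ring.jacobson R)] (R ⧸ Ring.jacobson R) :=
    { AddMonoidHom.id _ with
      map_smul' := fun r x => by
        obtain ⟨y, rfl⟩ := Ideal.Quotient.mk_surjective x
        rfl }
  exact (e.isSemisimpleModule_iff_of_bijective Function.bijective_id).1 hss

/-- A family of pairwise nonisomorphic simple modules annihilated by the kernel of a surjection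
onto a semisimple ring is finite. -/
lemma finite_of_simple_family {T : Type u} [Ring T] [IsSemisimpleRing T] (q : R →+* T)
    (hq : Function.Surjective q) {ι : Type u} (S : ι → Type u) [∀ i, AddCommGroup (S i)]
    [∀ i, Module R (S i)] [∀ i, IsSimpleModule R (S i)]
    (hinj : ∀ i j, Nonempty (S i ≃ₗ[R] S j) → i = j)
    (hker : ∀ r, q r = 0 → ∀ i (x : S i), r • x = 0) : Finite ι := by
  choose inst hS using fun i =>
    exists_module_of_ker_smul (M := S i) q hq fun r hr x => hker r hr i x
  have : RingHomSurjective q := ⟨hq⟩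
  have hsimple : ∀ i, IsSimpleModule T (S i) := fun i => by
    let e : S i →ₛₗ[q] S i := { AddMonoidHom.id _ with map_smul' := fun r x => (hS i r x).symm }
    exact (e.isSimpleModule_iff_of_bijective Function.bijective_id).1 inferInstance
  choose I eI using fun i =>
    IsSemisimpleRing.exists_linearEquiv_ideal_of_isSimpleModule T (S i)
  have hI : ∀ i, IsSimpleModule T (I i) := fun i => .congr (eI i).some.symm
  let c : ι → isotypicComponents T T := fun i =>
    ⟨isotypicComponent T T (I i), I i, hI i, rfl⟩
  refine Finite.of_injective c fun i j hij => hinj i j ?_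
  have hle : I i ≤ isotypicComponent T T (I j) := by
    have : isotypicComponent T T (I i) = isotypicComponent T T (I j) := congrArg Subtype.val hij
    exact this ▸ (I i).le_isotypicComponent
  obtain ⟨e⟩ := isIsotypicOfType_submodule_iff.1
    (IsIsotypicOfType.isotypicComponent T T (I j)) (I i) hle
  let e' : S i ≃ₗ[T] S j := (eI i).some.trans (e.trans (eI j).some.symm)
  exact ⟨{ e' with
    map_smul' := fun r x => by
      change e' (r • x) = r • e' x
      rw [← hS i, map_smul, hS j] }⟩

/-- Elements of the Jacobson radical annihilate simple left modules. -/
lemma smul_eq_zero_of_mem_jacobson {S : Type u} [AddCommGroup S] [Module R S]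
    [IsSimpleModule R S] {r : R} (hr : r ∈ Ring.jacobson R) (x : S) : r • x = 0 := by
  exact Module.mem_annihilator.1 (IsSemisimpleModule.jacobson_le_annihilator R S hr) x

/-- Elements of the Jacobson radical, defined by left ideals, annihilate simple right modules. -/
lemma op_smul_eq_zero_of_mem_jacobson_s12 {S : Type u} [AddCommGroup S] [Module Rᵐᵒᵖ S]
    [IsSimpleModule Rᵐᵒᵖ S] {r : R} (hr : r ∈ Ring.jacobson R) (x : S) : op r • x = 0 := by
  by_contra hx
  obtain ⟨a, ha⟩ := IsSimpleModule.toSpanSingleton_surjective Rᵐᵒᵖ hx x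
  have ha' : op (r * unop a) • x = x := by
    rw [op_mul, op_unop, mul_smul]
    exact ha
  have hj : r * unop a ∈ Ring.jacobson R := Ideal.mul_mem_right _ _ hr
  generalize r * unop a = j at ha' hj
  have hleft : ∀ u : R, u - 1 ∈ Ring.jacobson R → ∃ s, s * u = 1 := fun u hu => by
    obtain ⟨s, hs⟩ := Ideal.exists_mul_sub_mem_of_sub_one_mem_jacobson u
      (Ideal.jacobson_bot (R := R) ▸ hu)
    exact ⟨s, sub_eq_zero.1 hs⟩
  obtain ⟨s, hs⟩ := hleft (1 - j) (by simpa using hj)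
  have hs' : s - 1 = s * j := by rw [← hs]; noncomm_ring
  obtain ⟨t, ht⟩ := hleft s (hs' ▸ Ideal.mul_mem_left _ s hj)
  have hright : (1 - j) * s = 1 := by rwa [left_inv_eq_right_inv ht hs] at ht
  refine hx ?_
  rw [← one_smul Rᵐᵒᵖ x, ← op_one, ← hright, op_mul, mul_smul, op_sub, sub_smul, ha', op_one,
    one_smul, sub_self, smul_zero, smul_zero]

end Semilocal

/-! ### The asymmetric cover -/

/-- The reduction of the asymmetric cover modulo the square-zero ideal consisting of `S̄` and the
kernels of the projections `T(End_A(S)) → End_A(S)`. -/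
def asymCoverRed (A : Type u) [Ring A] {ι : Type u} (S : ι → Type u)
    [∀ i, AddCommGroup (S i)] [∀ i, Module Aᵐᵒᵖ (S i)] :
    AsymCover A S →+* A × (∀ i, EndS A S i) where
  toFun x := (x.a, fun i => (x.b i).fst)
  map_one' := rfl
  map_mul' _ _ := rfl
  map_zero' := rfl
  map_add' _ _ := rfl

section AsymCover
variable {A : Type u} [Ring A] {ι : Type u} (S : ι → Type u)
    [∀ i, AddCommGroup (S i)] [∀ i, Module Aᵐᵒᵖ (S i)]

lemma asymCoverRed_surjective : Function.Surjective (asymCoverRed A S) :=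
  fun x => ⟨⟨x.1, 0, fun i => TrivSqZeroExt.inl (x.2 i)⟩, rfl⟩

lemma mul_eq_zero_of_asymCoverRed_eq_zero (x y : AsymCover A S) (hx : asymCoverRed A S x = 0)
    (hy : asymCoverRed A S y = 0) : x * y = 0 := by
  have hxb : ∀ i, (x.b i).fst = 0 := fun i => congrFun (Prod.ext_iff.1 hx).2 i
  have hyb : ∀ i, (y.b i).fst = 0 := fun i => congrFun (Prod.ext_iff.1 hy).2 i
  have hxa : x.a = 0 := (Prod.ext_iff.1 hx).1
  have hya : y.a = 0 := (Prod.ext_iff.1 hy).1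
  refine Tri.ext ?_ ?_ ?_
  · rw [Tri.mul_a, hxa, zero_mul, Tri.zero_a]
  · rw [Tri.mul_m, hya, op_zero, zero_smul, zero_add, Tri.zero_m]
    refine DFinsupp.ext fun i => ?_
    rw [DirectSum.smul_apply, abar_smul_def, hxb]
    rfl
  · refine funext fun i => TrivSqZeroExt.ext ?_ ?_
    · simp [hxb]
    · simp [hxb, hyb]

lemma isSemisimpleRing_pi_endS (hfam : IsSimpleFamily A S) [Finite ι] :
    IsSemisimpleRing (∀ i, EndS A S i) := by
  have := hfam.1
  have : ∀ i, IsSemisimpleRing (EndS A S i) := fun i => IsSemisimpleRing.moduleEnd _ _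
  infer_instance

end AsymCover

lemma isLeftPerfect_of_isSemisimpleRing (R : Type u) [Ring R] [IsSemisimpleRing R] :
    IsLeftPerfect R := fun M _ _ =>
  ⟨M, _, _, LinearMap.id, Module.projective_of_isSemisimpleRing R M,
    IsSuperfluousEpi.of_bijective Function.bijective_id⟩

/-- If `A` is right perfect then so is its asymmetric cover
`Ã = [[A,0],[S̄,Ā]]`, and if `A` is left perfect then so is `Ã`. -/
theorem asymCover_perfect_of_perfect
    (A : Type u) [Ring A] {ι : Type u} (S : ι → Type u)
    [∀ i, AddCommGroup (S i)] [∀ i, Module Aᵐᵒᵖ (S i)]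
    (hfam : IsSimpleFamily A S) :
    (IsRightPerfect A → IsRightPerfect (AsymCover A S)) ∧
    (IsLeftPerfect A → IsLeftPerfect (AsymCover A S)) := by
  have := hfam.1
  constructor
  · intro h
    have h' : IsLeftPerfect Aᵐᵒᵖ := h
    have := h'.isSemisimpleRing_quotient
    have : Finite ι := finite_of_simple_family (Ideal.Quotient.mk (Ring.jacobson Aᵐᵒᵖ))
      Ideal.Quotient.mk_surjective S hfam.2.2 fun r hr i x =>
        smul_eq_zero_of_mem_jacobson (Ideal.Quotient.eq_zero_iff_mem.1 hr) x
    have := isSemisimpleRing_pi_endS S hfam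
    have hp := isLeftPerfect_prod h' (isLeftPerfect_of_isSemisimpleRing (∀ i, EndS A S i)ᵐᵒᵖ)
    refine hp.of_squareZero
      (RingHom.prod (RingHom.op ((RingHom.fst _ _).comp (asymCoverRed A S)))
        (RingHom.op ((RingHom.snd _ _).comp (asymCoverRed A S)))) (fun x => ?_)
      fun x y hx hy => ?_
    · obtain ⟨z, hz⟩ := asymCoverRed_surjective S (unop x.1, unop x.2)
      exact ⟨op z, Prod.ext (congrArg op (congrArg Prod.fst hz))
        (congrArg op (congrArg Prod.snd hz))⟩
    · refine unop_injective (mul_eq_zero_of_asymCoverRed_eq_zero S (unop y) (unop x) ?_ ?_)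
      · exact Prod.ext (congrArg unop (congrArg Prod.fst hy)) (congrArg unop (congrArg Prod.snd hy))
      · exact Prod.ext (congrArg unop (congrArg Prod.fst hx)) (congrArg unop (congrArg Prod.snd hx))
  · intro h
    have := h.isSemisimpleRing_quotient
    have : Finite ι := finite_of_simple_family
      (RingHom.op (Ideal.Quotient.mk (Ring.jacobson A)))
      (fun x => by
        obtain ⟨y, hy⟩ := Ideal.Quotient.mk_surjective (unop x)
        exact ⟨op y, congrArg op hy⟩) S hfam.2.2 fun r hr i x =>
        op_smul_eq_zero_of_mem_jacobson_s12 (r := unop r)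
          (Ideal.Quotient.eq_zero_iff_mem.1 (congrArg unop hr)) x
    have := isSemisimpleRing_pi_endS S hfam
    exact (isLeftPerfect_prod h
      (isLeftPerfect_of_isSemisimpleRing (∀ i, EndS A S i))).of_squareZero (asymCoverRed A S)
      (asymCoverRed_surjective S) (mul_eq_zero_of_asymCoverRed_eq_zero S)
end
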